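/- Let λ be a partition with exactly 2 distinct part sizes, μ = (μ_1^m) a rectangle with μ ⊆ λ, and suppose λ/μ is a basic connected skew diagram. If α/β is another basic skew diagram with β a rectangle and s_{λ/μ} = s_{α/β}, then α/β = λ/μ or α/β = (λ/μ)° (the 180° rotation) up to translation. -/

import Mathlib

open YoungDiagram
open scoped Classical

namespace LRSkew

/-- The cells of the skew diagram `lam/mu`. -/
def skewCells (lam mu : YoungDiagram) : Finset (ℕ × ℕ) := lam.cells \ mu.cells

/-- A semistandard filling of the skew shape `lam/mu`: entries are positive exactly on the
cells of the shape, rows are weakly increasing and columns are strictly increasing. -/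
def IsSSYT (lam mu : YoungDiagram) (T : ℕ × ℕ → ℕ) : Prop :=
  (∀ p, p ∈ skewCells lam mu ↔ T p ≠ 0) ∧
  (∀ i j1 j2, (i, j1) ∈ skewCells lam mu → (i, j2) ∈ skewCells lam mu → j1 ≤ j2 →
    T (i, j1) ≤ T (i, j2)) ∧
  (∀ i1 i2 j, (i1, j) ∈ skewCells lam mu → (i2, j) ∈ skewCells lam mu → i1 < i2 →
    T (i1, j) < T (i2, j))

/-- The number of entries equal to `k` among the cells read (in the reverse reading word:
right to left along rows, top row first) up to position `(i,j)`. -/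
def prefixCount (lam mu : YoungDiagram) (T : ℕ × ℕ → ℕ) (i j k : ℕ) : ℕ :=
  ((skewCells lam mu).filter fun p => (p.1 < i ∨ (p.1 = i ∧ j ≤ p.2)) ∧ T p = k).card

/-- The reverse reading word of the filling is a lattice word. -/
def IsLattice (lam mu : YoungDiagram) (T : ℕ × ℕ → ℕ) : Prop :=
  ∀ i j k, prefixCount lam mu T i j (k + 2) ≤ prefixCount lam mu T i j (k + 1)

/-- The number of entries of the filling equal to `k`. -/
def content (lam mu : YoungDiagram) (T : ℕ × ℕ → ℕ) (k : ℕ) : ℕ :=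
  ((skewCells lam mu).filter fun p => T p = k).card

/-- A Littlewood–Richardson tableau of shape `lam/mu` and content `nu`. -/
def IsLR (lam mu nu : YoungDiagram) (T : ℕ × ℕ → ℕ) : Prop :=
  IsSSYT lam mu T ∧ IsLattice lam mu T ∧ ∀ i, content lam mu T (i + 1) = nu.rowLen i

/-- The Littlewood–Richardson coefficient `c(lam; mu, nu)`. -/
noncomputable def lrCoeff (lam mu nu : YoungDiagram) : ℕ :=
  if mu ≤ lam then {T : ℕ × ℕ → ℕ | IsLR lam mu nu T}.ncard else 0

/-- Equality of the skew Schur functions `s_{lam/mu} = s_{alp/bet}`, expressed through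
their expansions into Schur functions. -/
def SchurEq (lam mu alp bet : YoungDiagram) : Prop :=
  ∀ nu : YoungDiagram, lrCoeff lam mu nu = lrCoeff alp bet nu

/-- The rectangular Young diagram `(k^l)` with `l` rows of length `k`. -/
def rect (k l : ℕ) : YoungDiagram :=
  ⟨Finset.range l ×ˢ Finset.range k, by
    intro a b hba ha
    simp only [Finset.coe_product, Set.mem_prod, Finset.mem_coe, Finset.mem_range] at ha ⊢
    exact ⟨lt_of_le_of_lt hba.1 ha.1, lt_of_le_of_lt hba.2 ha.2⟩⟩

/-- The complement of `nu` in the rectangle `(k^l)`, rotated by 180 degrees so that it is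
again a partition: its parts are `(k - nu_l, …, k - nu_1)`. -/
def complRect (k l : ℕ) (nu : YoungDiagram) : YoungDiagram :=
  ⟨(rect k l).cells.filter fun p => (l - 1 - p.1, k - 1 - p.2) ∉ nu, by
    intro a b hba ha
    simp only [Finset.coe_filter, Set.mem_setOf_eq, mem_cells] at ha ⊢
    refine ⟨(rect k l).isLowerSet hba ha.1, fun hmem => ha.2 ?_⟩
    exact nu.isLowerSet
      (Prod.mk_le_mk.mpr ⟨Nat.sub_le_sub_left hba.1 _, Nat.sub_le_sub_left hba.2 _⟩) hmem⟩

/-- The staircase partition `(n, n-1, …, 2, 1)`. -/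
def staircase (n : ℕ) : YoungDiagram :=
  ⟨(Finset.range n ×ˢ Finset.range n).filter fun p => p.1 + p.2 < n, by
    intro a b hba ha
    simp only [Finset.coe_filter, Set.mem_setOf_eq, Finset.mem_product, Finset.mem_range] at ha ⊢
    exact ⟨⟨lt_of_le_of_lt hba.1 ha.1.1, lt_of_le_of_lt hba.2 ha.1.2⟩,
      lt_of_le_of_lt (Nat.add_le_add hba.1 hba.2) ha.2⟩⟩

/-- A basic skew diagram: no empty rows and no empty columns. -/
def IsBasic (lam mu : YoungDiagram) : Prop :=
  (∀ i, i < lam.colLen 0 → mu.rowLen i < lam.rowLen i) ∧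
  (∀ j, j < lam.rowLen 0 → mu.colLen j < lam.colLen j)

/-- A (basic) skew diagram is connected iff consecutive rows share a column. -/
def IsConnectedSkew (lam mu : YoungDiagram) : Prop :=
  ∀ i, i + 1 < lam.colLen 0 → mu.rowLen i < lam.rowLen (i + 1)

/-- The number of distinct (positive) part sizes of a partition. -/
def dp (lam : YoungDiagram) : ℕ :=
  ((Finset.range (lam.colLen 0)).image fun i => lam.rowLen i).card

/-- A partition is a rectangle: all its parts are equal. -/
def IsRect (mu : YoungDiagram) : Prop :=
  ∀ i, i < mu.colLen 0 → mu.rowLen i = mu.rowLen 0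

/-- Cells of a skew diagram in the same connected component: the reflexive–transitive
closure of sharing a row or a column. -/
def SameComp (s : Finset (ℕ × ℕ)) : ℕ × ℕ → ℕ × ℕ → Prop :=
  Relation.ReflTransGen fun a b => a ∈ s ∧ b ∈ s ∧ (a.1 = b.1 ∨ a.2 = b.2)

/-- Two finite sets of boxes agree up to translation or 180°-rotation of each connected
component independently. -/
def UpToTransRot (s t : Finset (ℕ × ℕ)) : Prop :=
  ∃ f : ℕ × ℕ → ℕ × ℕ, Set.BijOn f ↑s ↑t ∧
    ∀ p ∈ s, ∀ q ∈ s, SameComp s p q →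
      (((f q).1 : ℤ) - (f p).1 = (q.1 : ℤ) - p.1 ∧ ((f q).2 : ℤ) - (f p).2 = (q.2 : ℤ) - p.2) ∨
      (((f q).1 : ℤ) - (f p).1 = (p.1 : ℤ) - q.1 ∧ ((f q).2 : ℤ) - (f p).2 = (p.2 : ℤ) - q.2)




/-- Prefix counts over a finite set of cells. -/
def pcnt (D : Finset (ℕ × ℕ)) (T : ℕ × ℕ → ℕ) (i j k : ℕ) : ℕ :=
  (D.filter fun p => (p.1 < i ∨ (p.1 = i ∧ j ≤ p.2)) ∧ T p = k).card

/-- Number of cells with a given entry. -/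
def cnt (D : Finset (ℕ × ℕ)) (T : ℕ × ℕ → ℕ) (k : ℕ) : ℕ :=
  (D.filter fun p => T p = k).card

/-- Littlewood–Richardson fillings of a finite set of cells. -/
structure LRF (D : Finset (ℕ × ℕ)) (T : ℕ × ℕ → ℕ) : Prop where
  supp : ∀ p, p ∈ D ↔ T p ≠ 0
  row : ∀ i j1 j2, (i, j1) ∈ D → (i, j2) ∈ D → j1 ≤ j2 → T (i, j1) ≤ T (i, j2)
  col : ∀ i1 i2 j, (i1, j) ∈ D → (i2, j) ∈ D → i1 < i2 → T (i1, j) < T (i2, j)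
  lat : ∀ i j k, pcnt D T i j (k + 2) ≤ pcnt D T i j (k + 1)

/-- Every content of an LR filling of `D` is a content of an LR filling of `D'`. -/
def Tr (D D' : Finset (ℕ × ℕ)) : Prop :=
  ∀ T, LRF D T → ∃ T', LRF D' T' ∧ ∀ k, cnt D T (k + 1) = cnt D' T' (k + 1)

lemma pcnt_le_cnt (D : Finset (ℕ × ℕ)) (T : ℕ × ℕ → ℕ) (i j k : ℕ) :
    pcnt D T i j k ≤ cnt D T k := by
  apply Finset.card_le_card
  intro p hp
  simp only [Finset.mem_filter] at hp ⊢
  exact ⟨hp.1, hp.2.2⟩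

lemma exists_bound (D : Finset (ℕ × ℕ)) (g : ℕ × ℕ → ℕ) : ∃ N, ∀ p ∈ D, g p < N := by
  refine ⟨D.sup g + 1, fun p hp => ?_⟩
  have := Finset.le_sup (f := g) hp
  omega

lemma cnt_anti {D : Finset (ℕ × ℕ)} {T : ℕ × ℕ → ℕ} (h : LRF D T) (k : ℕ) :
    cnt D T (k + 2) ≤ cnt D T (k + 1) := by
  obtain ⟨N, hN⟩ := exists_bound D Prod.fst
  have e : ∀ v, pcnt D T N 0 v = cnt D T v := by
    intro v
    unfold pcnt cnt
    congr 1
    apply Finset.filter_congr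
    intro p hp
    have := hN p hp
    simp [this]
  have := h.lat N 0 k
  rwa [e, e] at this

lemma cnt_antitone {D : Finset (ℕ × ℕ)} {T : ℕ × ℕ → ℕ} (h : LRF D T) :
    Antitone fun k => cnt D T (k + 1) :=
  antitone_nat_of_succ_le fun k => cnt_anti h k

lemma lat_le {D : Finset (ℕ × ℕ)} {T : ℕ × ℕ → ℕ} (h : LRF D T) (i j : ℕ) {v w : ℕ}
    (hv : 0 < v) (hvw : v ≤ w) : pcnt D T i j w ≤ pcnt D T i j v := by
  have : Antitone fun k => pcnt D T i j (k + 1) := antitone_nat_of_succ_le fun k => h.lat i j k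
  have h2 := this (show v - 1 ≤ w - 1 by omega)
  simp only at h2
  rwa [show w - 1 + 1 = w by omega, show v - 1 + 1 = v by omega] at h2

lemma exists_shape {D : Finset (ℕ × ℕ)} {T : ℕ × ℕ → ℕ} (h : LRF D T) :
    ∃ nu : YoungDiagram, ∀ i, cnt D T (i + 1) = nu.rowLen i := by
  obtain ⟨N, hN⟩ := exists_bound D T
  let nu : YoungDiagram :=
    ⟨(Finset.range N ×ˢ Finset.range (D.card + 1)).filter fun p => p.2 < cnt D T (p.1 + 1), by
      intro p q hqp hp
      simp only [Finset.coe_filter, Set.mem_ofPred_eq, Finset.mem_product, Finset.mem_range] at hp ⊢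
      have h1 : q.1 ≤ p.1 := hqp.1
      have h2 : q.2 ≤ p.2 := hqp.2
      have h3 := cnt_antitone h h1
      simp only at h3
      omega⟩
  refine ⟨nu, fun i => ?_⟩
  have key : ∀ j, j < nu.rowLen i ↔ j < cnt D T (i + 1) := by
    intro j
    rw [← YoungDiagram.mem_iff_lt_rowLen, ← YoungDiagram.mem_cells]
    simp only [nu, Finset.mem_filter, Finset.mem_product, Finset.mem_range]
    refine ⟨fun h => h.2, fun hj => ⟨⟨?_, ?_⟩, hj⟩⟩
    · have : 0 < cnt D T (i + 1) := by omega
      obtain ⟨p, hp⟩ := Finset.card_pos.mp this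
      simp only [Finset.mem_filter] at hp
      have := hN p hp.1
      omega
    · have : cnt D T (i + 1) ≤ D.card := Finset.card_filter_le _ _
      omega
  have a := key (nu.rowLen i)
  have b := key (cnt D T (i + 1))
  omega

lemma isLR_iff (lam mu nu : YoungDiagram) (T : ℕ × ℕ → ℕ) :
    IsLR lam mu nu T ↔ LRF (skewCells lam mu) T ∧
      ∀ i, cnt (skewCells lam mu) T (i + 1) = nu.rowLen i := by
  constructor
  · rintro ⟨⟨h1, h2, h3⟩, h4, h5⟩
    exact ⟨⟨h1, h2, h3, h4⟩, h5⟩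
  · rintro ⟨⟨h1, h2, h3, h4⟩, h5⟩
    exact ⟨⟨h1, h2, h3⟩, h4, h5⟩

lemma finite_LR (lam mu nu : YoungDiagram) : {T : ℕ × ℕ → ℕ | IsLR lam mu nu T}.Finite := by
  set D := skewCells lam mu with hD
  have hfin : (Set.pi Set.univ (fun _ : D => Set.Iic (nu.colLen 0))).Finite :=
    Set.Finite.pi fun _ => Set.finite_Iic _
  refine Set.Finite.of_injOn (f := fun (T : ℕ × ℕ → ℕ) (p : D) => T p.1) ?_ ?_ hfin
  · intro T hT
    obtain ⟨h1, h2⟩ := (isLR_iff _ _ _ _).mp hT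
    rw [← hD] at h1 h2
    intro p _
    simp only [Set.mem_Iic]
    have hp : T p.1 ≠ 0 := (h1.supp _).mp p.2
    have h3 := h2 (T p.1 - 1)
    rw [show T p.1 - 1 + 1 = T p.1 by omega] at h3
    have h4 : 0 < cnt D T (T p.1) :=
      Finset.card_pos.mpr ⟨p.1, by simp⟩
    rw [h3] at h4
    have h5 := YoungDiagram.mem_iff_lt_rowLen.mpr h4
    have := YoungDiagram.mem_iff_lt_colLen.mp h5
    omega
  · intro T hT T' hT' he
    obtain ⟨h1, _⟩ := (isLR_iff _ _ _ _).mp hT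
    obtain ⟨h1', _⟩ := (isLR_iff _ _ _ _).mp hT'
    funext p
    by_cases hp : p ∈ D
    · exact congrFun he ⟨p, hp⟩
    · have a : T p = 0 := by
        by_contra hh
        exact hp ((h1.supp p).mpr hh)
      have b : T' p = 0 := by
        by_contra hh
        exact hp ((h1'.supp p).mpr hh)
      rw [a, b]

lemma tr_of_schurEq {lam mu alp bet : YoungDiagram} (hmu : mu ≤ lam) (hbet : bet ≤ alp)
    (h : SchurEq lam mu alp bet) : Tr (skewCells lam mu) (skewCells alp bet) := by
  intro T hT
  obtain ⟨nu, hnu⟩ := exists_shape hT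
  have h1 : lrCoeff lam mu nu ≠ 0 := by
    unfold lrCoeff
    rw [if_pos hmu]
    exact Set.ncard_ne_zero_of_mem (a := T) ((isLR_iff _ _ _ _).mpr ⟨hT, hnu⟩)
      (finite_LR lam mu nu)
  rw [h nu] at h1
  unfold lrCoeff at h1
  rw [if_pos hbet] at h1
  obtain ⟨T', hT'⟩ := Set.nonempty_of_ncard_ne_zero h1
  obtain ⟨h2, h3⟩ := (isLR_iff _ _ _ _).mp hT'
  exact ⟨T', h2, fun k => by rw [hnu, h3]⟩

lemma mem_skew {lam mu : YoungDiagram} {i j : ℕ} :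
    (i, j) ∈ skewCells lam mu ↔ j < lam.rowLen i ∧ mu.rowLen i ≤ j := by
  unfold skewCells
  rw [Finset.mem_sdiff, YoungDiagram.mem_cells, YoungDiagram.mem_cells,
    YoungDiagram.mem_iff_lt_rowLen, YoungDiagram.mem_iff_lt_rowLen, not_lt]

lemma mem_skew_col {lam mu : YoungDiagram} {i j : ℕ} :
    (i, j) ∈ skewCells lam mu ↔ i < lam.colLen j ∧ mu.colLen j ≤ i := by
  unfold skewCells
  rw [Finset.mem_sdiff, YoungDiagram.mem_cells, YoungDiagram.mem_cells,
    YoungDiagram.mem_iff_lt_colLen, YoungDiagram.mem_iff_lt_colLen, not_lt]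

lemma row_col (lam : YoungDiagram) (i j : ℕ) : j < lam.rowLen i ↔ i < lam.colLen j := by
  rw [← YoungDiagram.mem_iff_lt_rowLen, YoungDiagram.mem_iff_lt_colLen]

/-- The rank of a cell among the cells with the same entry, in reading order (from 1). -/
def rk (D : Finset (ℕ × ℕ)) (T : ℕ × ℕ → ℕ) (p : ℕ × ℕ) : ℕ := pcnt D T p.1 p.2 (T p)

lemma rk_le_cnt (D : Finset (ℕ × ℕ)) (T : ℕ × ℕ → ℕ) (p : ℕ × ℕ) :
    rk D T p ≤ cnt D T (T p) := pcnt_le_cnt _ _ _ _ _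

lemma rk_lt {D : Finset (ℕ × ℕ)} {T : ℕ × ℕ → ℕ} {p q : ℕ × ℕ} (hq : q ∈ D)
    (hT : T p = T q) (h : p.1 < q.1 ∨ (p.1 = q.1 ∧ q.2 < p.2)) : rk D T p < rk D T q := by
  unfold rk pcnt
  apply Finset.card_lt_card
  rw [Finset.ssubset_iff_of_subset]
  · refine ⟨q, ?_, ?_⟩
    · simp [hq]
    · simp only [Finset.mem_filter]
      omega
  · intro x hx
    simp only [Finset.mem_filter] at hx ⊢
    refine ⟨hx.1, ?_, ?_⟩ <;> omega

lemma rk_inj {D : Finset (ℕ × ℕ)} {T : ℕ × ℕ → ℕ} {p q : ℕ × ℕ} (hp : p ∈ D) (hq : q ∈ D)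
    (hT : T p = T q) (h : rk D T p = rk D T q) : p = q := by
  by_contra hne
  have hne' : p.1 ≠ q.1 ∨ p.2 ≠ q.2 := by
    by_contra hh
    push Not at hh
    exact hne (Prod.ext hh.1 hh.2)
  rcases lt_trichotomy p.1 q.1 with h1 | h1 | h1
  · have := rk_lt hq hT (Or.inl h1); omega
  · rcases lt_trichotomy p.2 q.2 with h2 | h2 | h2
    · have := rk_lt hp hT.symm (Or.inr ⟨h1.symm, h2⟩); omega
    · omega
    · have := rk_lt hq hT (Or.inr ⟨h1, h2⟩); omega
  · have := rk_lt hp hT.symm (Or.inl h1); omega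

/-- The ranks strictly increase from right to left along a row. -/
lemma rk_succ {D : Finset (ℕ × ℕ)} {T : ℕ × ℕ → ℕ} (h : LRF D T) {i j : ℕ}
    (h1 : (i, j) ∈ D) (h2 : (i, j + 1) ∈ D) : rk D T (i, j + 1) < rk D T (i, j) := by
  have hle := h.row i j (j + 1) h1 h2 (by omega)
  have hpos := (h.supp _).mp h1
  have h3 : rk D T (i, j + 1) ≤ pcnt D T i (j + 1) (T (i, j)) :=
    lat_le h i (j + 1) (by omega) hle
  refine lt_of_le_of_lt h3 ?_
  unfold rk pcnt
  apply Finset.card_lt_card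
  rw [Finset.ssubset_iff_of_subset]
  · refine ⟨(i, j), ?_, ?_⟩
    · simp [h1]
    · simp
  · intro x hx
    simp only [Finset.mem_filter] at hx ⊢
    refine ⟨hx.1, ?_, hx.2.2⟩
    omega

lemma rk_ge {lam mu : YoungDiagram} {T : ℕ × ℕ → ℕ} (h : LRF (skewCells lam mu) T) {i j : ℕ}
    (h1 : (i, j) ∈ skewCells lam mu) : lam.rowLen i - j ≤ rk (skewCells lam mu) T (i, j) := by
  obtain ⟨s, hs⟩ : ∃ s, lam.rowLen i - j = s + 1 := by
    have := (mem_skew.mp h1).1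
    exact ⟨lam.rowLen i - j - 1, by omega⟩
  induction s generalizing j with
  | zero =>
    rw [hs]
    exact Finset.card_pos.mpr ⟨(i, j), by simp [h1]⟩
  | succ s ih =>
    have h2 : (i, j + 1) ∈ skewCells lam mu := by
      have := mem_skew.mp h1
      rw [mem_skew]; omega
    have := ih h2 (by omega)
    have := rk_succ h h1 h2
    omega

lemma val_ge {lam mu : YoungDiagram} {T : ℕ × ℕ → ℕ} (h : LRF (skewCells lam mu) T) {i j : ℕ}
    (h1 : (i, j) ∈ skewCells lam mu) : i - mu.colLen j + 1 ≤ T (i, j) := by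
  obtain ⟨s, hs⟩ : ∃ s, i - mu.colLen j = s := ⟨_, rfl⟩
  induction s generalizing i with
  | zero =>
    have := (h.supp _).mp h1
    omega
  | succ s ih =>
    have h0 := mem_skew_col.mp h1
    have h2 : (i - 1, j) ∈ skewCells lam mu := by
      rw [mem_skew_col]; omega
    have := ih h2 (by omega)
    have := h.col (i - 1) i j h2 h1 (by omega)
    omega

/-- The number of positions of a `(k+1) × (t+1)` rectangle inside the skew diagram. -/
def Q (lam mu : YoungDiagram) (k t : ℕ) : ℕ :=
  ((skewCells lam mu).filter fun p => (p.1 + k, p.2 + t) ∈ lam).card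

/-- The cells with at least `k` cells above and at least `t` cells to the right. -/
def QS (lam mu : YoungDiagram) (k t : ℕ) : Finset (ℕ × ℕ) :=
  (skewCells lam mu).filter fun p => mu.colLen p.2 + k ≤ p.1 ∧ p.2 + t < lam.rowLen p.1

lemma card_QS (lam mu : YoungDiagram) (k t : ℕ) : (QS lam mu k t).card = Q lam mu k t := by
  symm
  unfold Q QS
  refine Finset.card_bij' (fun p _ => (p.1 + k, p.2)) (fun p _ => (p.1 - k, p.2)) ?_ ?_ ?_ ?_
  · rintro ⟨i, j⟩ hp
    simp only [Finset.mem_filter, mem_skew_col, YoungDiagram.mem_iff_lt_rowLen] at hp ⊢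
    refine ⟨⟨?_, by omega⟩, by omega, hp.2⟩
    rw [← row_col]; omega
  · rintro ⟨i, j⟩ hp
    simp only [Finset.mem_filter, mem_skew_col, YoungDiagram.mem_iff_lt_rowLen] at hp ⊢
    rw [show i - k + k = i by omega]
    refine ⟨⟨by omega, by omega⟩, by omega⟩
  · rintro ⟨i, j⟩ hp
    simp
  · rintro ⟨i, j⟩ hp
    simp only [Finset.mem_filter, mem_skew_col] at hp
    simp only [Prod.mk.injEq, and_true]
    omega

lemma Q_lower {lam mu : YoungDiagram} {T : ℕ × ℕ → ℕ} (h : LRF (skewCells lam mu) T)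
    (k t L : ℕ) (hL : ∀ p ∈ skewCells lam mu, T p < L) :
    Q lam mu k t ≤ ∑ v ∈ Finset.range L, (cnt (skewCells lam mu) T (k + v + 1) - t) := by
  rw [← card_QS]
  have hm : ∀ p ∈ QS lam mu k t, T p - (k + 1) ∈ Finset.range L := by
    rintro ⟨i, j⟩ hp
    have := hL _ (Finset.mem_filter.mp hp).1
    rw [Finset.mem_range]; omega
  rw [Finset.card_eq_sum_card_fiberwise hm]
  apply Finset.sum_le_sum
  intro v _
  have : (cnt (skewCells lam mu) T (k + v + 1) - t) =
      (Finset.Ioc t (cnt (skewCells lam mu) T (k + v + 1))).card := by simp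
  rw [this]
  have hT : ∀ p ∈ (QS lam mu k t).filter (fun p => T p - (k + 1) = v), T p = k + v + 1 := by
    rintro ⟨i, j⟩ hp
    simp only [QS, Finset.mem_filter] at hp
    have := val_ge h hp.1.1
    omega
  apply Finset.card_le_card_of_injOn (rk (skewCells lam mu) T)
  · rintro ⟨i, j⟩ hp
    have h1 := hT _ hp
    simp only [QS, Finset.mem_filter, Finset.mem_coe] at hp
    simp only [Finset.coe_Ioc, Set.mem_Ioc]
    have := rk_ge h hp.1.1
    have := rk_le_cnt (skewCells lam mu) T (i, j)
    rw [h1] at this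
    omega
  · intro p hp q hq he
    have h1 := hT _ hp
    have h2 := hT _ hq
    simp only [QS, Finset.mem_filter, Finset.mem_coe] at hp hq
    exact rk_inj hp.1.1 hq.1.1 (by rw [h1, h2]) he

/-- The lattice condition from an injection lowering entries by one. -/
lemma lat_of_inj {D : Finset (ℕ × ℕ)} {T : ℕ × ℕ → ℕ} (f : ℕ × ℕ → ℕ × ℕ)
    (hf : ∀ p ∈ D, 2 ≤ T p → f p ∈ D ∧ T (f p) + 1 = T p ∧
      ((f p).1 < p.1 ∨ ((f p).1 = p.1 ∧ p.2 ≤ (f p).2)))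
    (hinj : ∀ p ∈ D, ∀ q ∈ D, 2 ≤ T p → T p = T q → f p = f q → p = q) :
    ∀ i j k, pcnt D T i j (k + 2) ≤ pcnt D T i j (k + 1) := by
  intro i j k
  unfold pcnt
  apply Finset.card_le_card_of_injOn f
  · intro p hp
    simp only [Finset.mem_filter, Finset.mem_coe] at hp ⊢
    obtain ⟨h1, h2, h3⟩ := hf p hp.1 (by omega)
    refine ⟨h1, ?_, ?_⟩ <;> omega
  · intro p hp q hq he
    simp only [Finset.mem_filter, Finset.mem_coe] at hp hq
    exact hinj p hp.1 q hq.1 (by omega) (by omega) he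

/-- The number of cells in row `i` having at least `k` cells above them. -/
def wr (lam mu : YoungDiagram) (k i : ℕ) : ℕ :=
  if k ≤ i then lam.rowLen i - mu.rowLen (i - k) else 0

def wS (lam mu : YoungDiagram) (k i s : ℕ) : Finset ℕ :=
  (Finset.range (i + 1)).filter fun i' => s < wr lam mu k i'

/-- The filling with greedy columns for the first `k` values and greedy rows afterwards. -/
def wF (lam mu : YoungDiagram) (k : ℕ) (p : ℕ × ℕ) : ℕ :=
  if p ∈ skewCells lam mu then
    if p.1 < mu.colLen p.2 + k then p.1 - mu.colLen p.2 + 1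
    else k + (wS lam mu k p.1 (lam.rowLen p.1 - 1 - p.2)).card
  else 0

lemma wr_iff {lam mu : YoungDiagram} {k i j : ℕ} (h : (i, j) ∈ skewCells lam mu) :
    mu.colLen j + k ≤ i ↔ lam.rowLen i - 1 - j < wr lam mu k i := by
  have h1 := mem_skew.mp h
  unfold wr
  split_ifs with hk
  · have := row_col mu (i - k) j
    omega
  · omega

lemma wS_mono {lam mu : YoungDiagram} {k i i' s s' : ℕ} (h : i ≤ i') (hs : s' ≤ s) :
    wS lam mu k i s ⊆ wS lam mu k i' s' := by
  intro x hx
  simp only [wS, Finset.mem_filter, Finset.mem_range] at hx ⊢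
  omega

lemma wS_lt {lam mu : YoungDiagram} {k i i' s s' : ℕ} (h : i < i') (hs : s' ≤ s)
    (h2 : s' < wr lam mu k i') :
    (wS lam mu k i s).card < (wS lam mu k i' s').card := by
  apply Finset.card_lt_card
  rw [Finset.ssubset_iff_of_subset (wS_mono h.le hs)]
  refine ⟨i', ?_, ?_⟩ <;> simp only [wS, Finset.mem_filter, Finset.mem_range] <;> omega

lemma wS_pos {lam mu : YoungDiagram} {k i s : ℕ} (h : s < wr lam mu k i) :
    0 < (wS lam mu k i s).card := by
  apply Finset.card_pos.mpr
  refine ⟨i, ?_⟩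
  simp only [wS, Finset.mem_filter, Finset.mem_range]
  omega

lemma wS_prev {lam mu : YoungDiagram} {k i s : ℕ} (h : s < wr lam mu k i)
    (h2 : 2 ≤ (wS lam mu k i s).card) :
    ∃ i', i' < i ∧ s < wr lam mu k i' ∧ (wS lam mu k i' s).card + 1 = (wS lam mu k i s).card := by
  have hi : i ∈ wS lam mu k i s := by
    simp only [wS, Finset.mem_filter, Finset.mem_range]; omega
  have hne : ((wS lam mu k i s).erase i).Nonempty := by
    rw [← Finset.card_pos, Finset.card_erase_of_mem hi]; omega
  set m := ((wS lam mu k i s).erase i).max' hne with hm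
  have hmm := Finset.max'_mem _ hne
  rw [← hm, Finset.mem_erase] at hmm
  have hmm' := hmm.2
  simp only [wS, Finset.mem_filter, Finset.mem_range] at hmm'
  refine ⟨m, by omega, hmm'.2, ?_⟩
  have : wS lam mu k m s = (wS lam mu k i s).erase i := by
    ext x
    constructor
    · intro hx
      simp only [wS, Finset.mem_filter, Finset.mem_range, Finset.mem_erase] at hx ⊢
      omega
    · intro hx
      have := Finset.le_max' _ _ hx
      simp only [wS, Finset.mem_filter, Finset.mem_range, Finset.mem_erase] at hx ⊢
      omega
  rw [this, Finset.card_erase_of_mem hi]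
  omega

lemma wF_pos_inj {lam mu : YoungDiagram} {k : ℕ} {p q : ℕ × ℕ} (hp : p ∈ skewCells lam mu)
    (hq : q ∈ skewCells lam mu) (hk : k < wF lam mu k p) (he : wF lam mu k p = wF lam mu k q)
    (hs : lam.rowLen p.1 - 1 - p.2 = lam.rowLen q.1 - 1 - q.2) : p = q := by
  obtain ⟨i, j⟩ := p
  obtain ⟨i', j'⟩ := q
  simp only at hs
  have e1 : ∀ i j, (i, j) ∈ skewCells lam mu → k < wF lam mu k (i, j) →
      wF lam mu k (i, j) = k + (wS lam mu k i (lam.rowLen i - 1 - j)).card ∧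
      lam.rowLen i - 1 - j < wr lam mu k i := by
    intro i j h hk
    unfold wF at hk ⊢
    have := wr_iff (k := k) h
    have := mem_skew_col.mp h
    simp only [h, if_true] at hk ⊢
    split_ifs at hk ⊢ with h3
    · omega
    · exact ⟨rfl, by omega⟩
  obtain ⟨a1, a2⟩ := e1 _ _ hp hk
  obtain ⟨b1, b2⟩ := e1 _ _ hq (by omega)
  have hp' := mem_skew.mp hp
  have hq' := mem_skew.mp hq
  rcases lt_trichotomy i i' with h | h | h
  · have := wS_lt h hs.ge b2
    omega
  · subst h
    rw [Prod.mk.injEq]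
    omega
  · have := wS_lt h hs.le a2
    omega

lemma wF_LRF (lam mu : YoungDiagram) (k : ℕ) : LRF (skewCells lam mu) (wF lam mu k) := by
  have hcol : ∀ i1 i2 j, (i1, j) ∈ skewCells lam mu → (i2, j) ∈ skewCells lam mu → i1 < i2 →
      wF lam mu k (i1, j) < wF lam mu k (i2, j) := by
    intro i1 i2 j h1 h2 hlt
    unfold wF
    have a1 := wr_iff (k := k) h1
    have a2 := wr_iff (k := k) h2
    have b1 := mem_skew_col.mp h1
    have hl := lam.rowLen_anti i1 i2 hlt.le
    simp only [h1, h2, if_true]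
    split_ifs with h3 h4 h4
    · omega
    · have := wS_pos (a2.mp (by omega)); omega
    · omega
    · have := wS_lt (s := lam.rowLen i1 - 1 - j) (s' := lam.rowLen i2 - 1 - j) hlt (by omega)
        (a2.mp (by omega))
      omega
  refine ⟨?_, ?_, hcol, ?_⟩
  · intro p
    unfold wF
    by_cases hp : p ∈ skewCells lam mu
    · have := wr_iff (k := k) (i := p.1) (j := p.2) hp
      simp only [hp, if_true, true_iff]
      split_ifs with h3
      · omega
      · have := wS_pos (this.mp (by omega)); omega
    · simp [hp]
  · intro i j1 j2 h1 h2 hle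
    unfold wF
    have a1 := wr_iff (k := k) h1
    have a2 := wr_iff (k := k) h2
    have b1 := mem_skew_col.mp h1
    have hl := mu.colLen_anti j1 j2 hle
    simp only [h1, h2, if_true]
    split_ifs with h3 h4 h4
    · omega
    · have := wS_pos (a2.mp (by omega)); omega
    · omega
    · have := Finset.card_le_card (wS_mono (lam := lam) (mu := mu) (k := k) (i := i) le_rfl
        (show lam.rowLen i - 1 - j2 ≤ lam.rowLen i - 1 - j1 by omega))
      omega
  · have key : ∀ p ∈ skewCells lam mu, k + 2 ≤ wF lam mu k p → ∃ q ∈ skewCells lam mu,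
        wF lam mu k q + 1 = wF lam mu k p ∧ q.1 < p.1 ∧
        lam.rowLen q.1 - 1 - q.2 = lam.rowLen p.1 - 1 - p.2 := by
      rintro ⟨i, j⟩ hp h2
      have hp1 := mem_skew.mp hp
      have a := wr_iff (k := k) hp
      have e : mu.colLen j + k ≤ i ∧
          wF lam mu k (i, j) = k + (wS lam mu k i (lam.rowLen i - 1 - j)).card := by
        unfold wF at h2 ⊢
        simp only [hp, if_true] at h2 ⊢
        split_ifs at h2 ⊢ with h3
        · omega
        · exact ⟨by omega, rfl⟩
      obtain ⟨e1, e2⟩ := e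
      obtain ⟨i', c1, c2, c3⟩ := wS_prev (a.mp e1) (by omega)
      have hq : (i', lam.rowLen i' - 1 - (lam.rowLen i - 1 - j)) ∈ skewCells lam mu := by
        rw [mem_skew]
        unfold wr at c2
        split_ifs at c2 with hk
        · have := mu.rowLen_anti (i' - k) i' (by omega)
          omega
        · omega
      have c2' : lam.rowLen i - 1 - j < lam.rowLen i' := by
        unfold wr at c2
        split_ifs at c2 <;> omega
      refine ⟨_, hq, ?_, c1, ?_⟩
      · have a' := wr_iff (k := k) hq
        rw [show lam.rowLen i' - 1 - (lam.rowLen i' - 1 - (lam.rowLen i - 1 - j)) =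
          lam.rowLen i - 1 - j by omega] at a'
        rw [e2]
        unfold wF
        simp only [hq, if_true]
        rw [if_neg (by omega), show lam.rowLen i' - 1 - (lam.rowLen i' - 1 -
          (lam.rowLen i - 1 - j)) = lam.rowLen i - 1 - j by omega]
        omega
      · simp only; omega
    have key2 : ∀ i j, (i, j) ∈ skewCells lam mu → 2 ≤ wF lam mu k (i, j) →
        wF lam mu k (i, j) ≤ k + 1 → 1 ≤ i ∧ (i - 1, j) ∈ skewCells lam mu ∧
        wF lam mu k (i - 1, j) + 1 = wF lam mu k (i, j) := by
      intro i j hp h2 h3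
      have hp1 := mem_skew_col.mp hp
      by_cases hd : mu.colLen j < i
      · have hq : (i - 1, j) ∈ skewCells lam mu := by
          rw [mem_skew_col]; omega
        refine ⟨by omega, hq, ?_⟩
        have hc := hcol (i - 1) i j hq hp (by omega)
        have a := wr_iff (k := k) hp
        have a' := wr_iff (k := k) hq
        unfold wF at h2 h3 hc ⊢
        simp only [hp, hq, if_true] at h2 h3 hc ⊢
        by_cases c1 : i < mu.colLen j + k
        · rw [if_pos c1, if_pos (by omega)]
          omega
        · rw [if_neg c1] at h2 h3 hc ⊢
          have := wS_pos (a.mp (by omega))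
          by_cases c2 : i - 1 < mu.colLen j + k
          · rw [if_pos c2]
            omega
          · rw [if_neg c2] at hc ⊢
            have := wS_pos (a'.mp (by omega))
            omega
      · exfalso
        have a := wr_iff (k := k) hp
        unfold wF at h2 h3
        simp only [hp, if_true] at h2 h3
        split_ifs at h2 h3 with c1
        · omega
        · have hk : k = 0 := by omega
          omega
    let f : ℕ × ℕ → ℕ × ℕ := fun p =>
      if h : p ∈ skewCells lam mu ∧ k + 2 ≤ wF lam mu k p then (key p h.1 h.2).choose
      else (p.1 - 1, p.2)
    have f1 : ∀ p (hp : p ∈ skewCells lam mu) (h2 : k + 2 ≤ wF lam mu k p),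
        f p ∈ skewCells lam mu ∧ wF lam mu k (f p) + 1 = wF lam mu k p ∧ (f p).1 < p.1 ∧
        lam.rowLen (f p).1 - 1 - (f p).2 = lam.rowLen p.1 - 1 - p.2 := by
      intro p hp h2
      have : f p = (key p hp h2).choose := dif_pos ⟨hp, h2⟩
      rw [this]
      exact (key p hp h2).choose_spec
    have f2 : ∀ p, ¬ (k + 2 ≤ wF lam mu k p) → f p = (p.1 - 1, p.2) := by
      intro p h2
      exact dif_neg (fun h => h2 h.2)
    apply lat_of_inj f
    · intro p hp h2
      by_cases h3 : k + 2 ≤ wF lam mu k p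
      · obtain ⟨g1, g2, g3, g4⟩ := f1 p hp h3
        exact ⟨g1, g2, Or.inl g3⟩
      · rw [f2 p h3]
        obtain ⟨g1, g2, g3⟩ := key2 p.1 p.2 hp h2 (by change wF lam mu k p ≤ _; omega)
        refine ⟨g2, g3, Or.inl ?_⟩
        simp only; omega
    · intro p hp q hq h2 he hf
      by_cases h3 : k + 2 ≤ wF lam mu k p
      · obtain ⟨g1, g2, g3, g4⟩ := f1 p hp h3
        obtain ⟨g1', g2', g3', g4'⟩ := f1 q hq (by omega)
        apply wF_pos_inj hp hq (by omega) he
        rw [← g4, ← g4', hf]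
      · rw [f2 p h3, f2 q (by omega), Prod.mk.injEq] at hf
        obtain ⟨g1, g2, g3⟩ := key2 p.1 p.2 hp h2 (by change wF lam mu k p ≤ _; omega)
        obtain ⟨g1', g2', g3'⟩ := key2 q.1 q.2 hq (by change 2 ≤ wF lam mu k q; omega)
          (by change wF lam mu k q ≤ _; omega)
        exact Prod.ext (by omega) hf.2

lemma Q_upper (lam mu : YoungDiagram) (k t L : ℕ) :
    ∑ v ∈ Finset.range L, (cnt (skewCells lam mu) (wF lam mu k) (k + v + 1) - t) ≤
      Q lam mu k t := by
  rw [← card_QS]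
  have h1 : ∀ v, cnt (skewCells lam mu) (wF lam mu k) (k + v + 1) - t ≤
      ((QS lam mu k t).filter fun p => wF lam mu k p = k + v + 1).card := by
    intro v
    have hsplit := Finset.card_filter_add_card_filter_not
      (s := (skewCells lam mu).filter fun p => wF lam mu k p = k + v + 1)
      (fun p => lam.rowLen p.1 - 1 - p.2 < t)
    have hA : (((skewCells lam mu).filter fun p => wF lam mu k p = k + v + 1).filter
        (fun p => lam.rowLen p.1 - 1 - p.2 < t)).card ≤ t := by
      conv_rhs => rw [← Finset.card_range t]
      apply Finset.card_le_card_of_injOn (fun p => lam.rowLen p.1 - 1 - p.2)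
      · intro p hp
        simp only [Finset.mem_filter, Finset.mem_coe, Finset.mem_range] at hp ⊢
        exact hp.2
      · intro p hp q hq he
        simp only [Finset.mem_filter, Finset.mem_coe] at hp hq
        exact wF_pos_inj hp.1.1 hq.1.1 (k := k) (by omega) (by omega) he
    have hB : (((skewCells lam mu).filter fun p => wF lam mu k p = k + v + 1).filter
        (fun p => ¬ lam.rowLen p.1 - 1 - p.2 < t)).card ≤
        ((QS lam mu k t).filter fun p => wF lam mu k p = k + v + 1).card := by
      apply Finset.card_le_card
      rintro ⟨i, j⟩ hp
      simp only [QS, Finset.mem_filter] at hp ⊢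
      obtain ⟨⟨g1, g2⟩, g3⟩ := hp
      have g4 := mem_skew.mp g1
      have g5 := mem_skew_col.mp g1
      refine ⟨⟨g1, ?_, by omega⟩, g2⟩
      by_contra hc
      unfold wF at g2
      simp only [g1, if_true] at g2
      rw [if_pos (by omega)] at g2
      omega
    unfold cnt
    omega
  calc _ ≤ ∑ v ∈ Finset.range L, ((QS lam mu k t).filter fun p => wF lam mu k p = k + v + 1).card :=
        Finset.sum_le_sum fun v _ => h1 v
    _ ≤ _ := by
      rw [← Finset.card_biUnion]
      · apply Finset.card_le_card
        intro p hp
        simp only [Finset.mem_biUnion, Finset.mem_filter] at hp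
        obtain ⟨_, _, h, _⟩ := hp
        exact h
      · intro x _ y _ hxy
        rw [Function.onFun, Finset.disjoint_left]
        intro p hp hq
        simp only [Finset.mem_filter] at hp hq
        omega

lemma Q_le_of_tr {lam mu alp bet : YoungDiagram}
    (h : Tr (skewCells lam mu) (skewCells alp bet)) (k t : ℕ) :
    Q alp bet k t ≤ Q lam mu k t := by
  obtain ⟨T', h1, h2⟩ := h _ (wF_LRF lam mu k)
  obtain ⟨L, hL⟩ := exists_bound (skewCells alp bet) T'
  refine (Q_lower h1 k t L hL).trans (le_trans (le_of_eq ?_) (Q_upper lam mu k t L))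
  apply Finset.sum_congr rfl
  intro v _
  rw [h2]

lemma Q_eq {lam mu alp bet : YoungDiagram} (hmu : mu ≤ lam) (hbet : bet ≤ alp)
    (h : SchurEq lam mu alp bet) (k t : ℕ) : Q alp bet k t = Q lam mu k t :=
  le_antisymm (Q_le_of_tr (tr_of_schurEq hmu hbet h) k t)
    (Q_le_of_tr (tr_of_schurEq hbet hmu fun nu => (h nu).symm) k t)

lemma E_rect {alp bet : YoungDiagram} {d n : ℕ}
    (hb : ∀ i, bet.rowLen i = if i < n then d else 0) (k t : ℕ) :
    Q alp bet k t = Q alp bet k (t + 1) +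
      (min n (alp.colLen (d + t) - k) + (alp.colLen t - (k + n))) := by
  have hsplit := Finset.card_filter_add_card_filter_not
    (s := (skewCells alp bet).filter fun p => (p.1 + k, p.2 + t) ∈ alp)
    (fun p => (p.1 + k, p.2 + (t + 1)) ∈ alp)
  have h1 : (((skewCells alp bet).filter fun p => (p.1 + k, p.2 + t) ∈ alp).filter
      (fun p => (p.1 + k, p.2 + (t + 1)) ∈ alp)) =
      (skewCells alp bet).filter fun p => (p.1 + k, p.2 + (t + 1)) ∈ alp := by
    ext ⟨i, j⟩
    simp only [Finset.mem_filter, mem_iff_lt_rowLen]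
    constructor
    · rintro ⟨⟨a, b⟩, c⟩; exact ⟨a, c⟩
    · rintro ⟨a, c⟩; exact ⟨⟨a, by omega⟩, c⟩
  have h2 : (((skewCells alp bet).filter fun p => (p.1 + k, p.2 + t) ∈ alp).filter
      (fun p => ¬ (p.1 + k, p.2 + (t + 1)) ∈ alp)).card =
      (Finset.range (min n (alp.colLen (d + t) - k)) ∪
        Finset.Ico n (alp.colLen t - k)).card := by
    refine Finset.card_bij' (fun p _ => p.1) (fun i _ => (i, alp.rowLen (i + k) - t - 1))
      ?_ ?_ ?_ ?_
    · rintro ⟨i, j⟩ hp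
      simp only [Finset.mem_filter, mem_iff_lt_rowLen, mem_skew, hb] at hp
      simp only [Finset.mem_union, Finset.mem_range, Finset.mem_Ico]
      have e1 := row_col alp (i + k) (d + t)
      have e2 := row_col alp (i + k) t
      split_ifs at hp <;> omega
    · intro i hi
      simp only [Finset.mem_union, Finset.mem_range, Finset.mem_Ico] at hi
      simp only [Finset.mem_filter, mem_iff_lt_rowLen, mem_skew, hb]
      have e1 := row_col alp (i + k) (d + t)
      have e2 := row_col alp (i + k) t
      have e3 := alp.rowLen_anti i (i + k) (by omega)
      split_ifs <;> omega
    · rintro ⟨i, j⟩ hp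
      simp only [Finset.mem_filter, mem_iff_lt_rowLen] at hp
      change (i, alp.rowLen (i + k) - t - 1) = (i, j)
      rw [Prod.mk.injEq]
      omega
    · intro i hi
      rfl
  rw [Finset.card_union_of_disjoint, Finset.card_range, Nat.card_Ico] at h2
  · rw [h1, h2] at hsplit
    unfold Q
    omega
  · rw [Finset.disjoint_left]
    intro x hx hy
    simp only [Finset.mem_range, Finset.mem_Ico] at hx hy
    omega

lemma mem_skew_tr {lam mu : YoungDiagram} {i j : ℕ} :
    (i, j) ∈ skewCells lam.transpose mu.transpose ↔ (j, i) ∈ skewCells lam mu := by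
  unfold skewCells
  simp

lemma Q_tr (lam mu : YoungDiagram) (k t : ℕ) :
    Q lam.transpose mu.transpose t k = Q lam mu k t := by
  unfold Q
  refine Finset.card_bij' (fun p _ => (p.2, p.1)) (fun p _ => (p.2, p.1)) ?_ ?_ ?_ ?_
  · rintro ⟨i, j⟩ hp
    simpa [Finset.mem_filter, mem_skew_tr, YoungDiagram.mem_transpose] using hp
  · rintro ⟨i, j⟩ hp
    simpa [Finset.mem_filter, mem_skew_tr, YoungDiagram.mem_transpose] using hp
  · intro p _; rfl
  · intro p _; rfl

lemma rect_tr {bet : YoungDiagram} {d n : ℕ}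
    (hb : ∀ i, bet.rowLen i = if i < n then d else 0) (j : ℕ) :
    bet.colLen j = if j < d then n else 0 := by
  have e : ∀ i, i < bet.colLen j ↔ (i < n ∧ j < d) := by
    intro i
    rw [← row_col, hb]
    split_ifs <;> omega
  have e1 := e (bet.colLen j)
  have e2 := e n
  have e3 := e (bet.colLen j - 1)
  have e4 := e (n - 1)
  split_ifs <;> omega

/-- The basic numerical consequence of the equality of skew Schur functions. -/
lemma E_eq {lam mu alp bet : YoungDiagram} {c m d n : ℕ}
    (hm : ∀ i, mu.rowLen i = if i < m then c else 0)
    (hb : ∀ i, bet.rowLen i = if i < n then d else 0)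
    (h : ∀ k t, Q alp bet k t = Q lam mu k t) (k t : ℕ) :
    min n (alp.colLen (d + t) - k) + (alp.colLen t - (k + n)) =
      min m (lam.colLen (c + t) - k) + (lam.colLen t - (k + m)) := by
  have h1 := E_rect (alp := alp) hb k t
  have h2 := E_rect (alp := lam) hm k t
  have h3 := h k t
  have h4 := h k (t + 1)
  omega

lemma E_eq_tr {lam mu alp bet : YoungDiagram} {c m d n : ℕ}
    (hm : ∀ i, mu.rowLen i = if i < m then c else 0)
    (hb : ∀ i, bet.rowLen i = if i < n then d else 0)
    (h : ∀ k t, Q alp bet k t = Q lam mu k t) (k t : ℕ) :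
    min d (alp.rowLen (n + t) - k) + (alp.rowLen t - (k + d)) =
      min c (lam.rowLen (m + t) - k) + (lam.rowLen t - (k + c)) := by
  have := E_eq (lam := lam.transpose) (mu := mu.transpose) (alp := alp.transpose)
    (bet := bet.transpose) (c := m) (m := c) (d := n) (n := d)
    (fun i => by rw [YoungDiagram.rowLen_transpose]; exact rect_tr hm i)
    (fun i => by rw [YoungDiagram.rowLen_transpose]; exact rect_tr hb i)
    (fun k t => by rw [Q_tr, Q_tr]; exact h t k) k t
  simpa only [YoungDiagram.colLen_transpose] using this

lemma loc4 {m n x y u v : ℕ} (hm : 0 < m) (hn : 0 < n) (hx : n < x) (hxy : x ≤ y)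
    (hu : m < u) (huv : u ≤ v)
    (h : ∀ k, min n (x - k) + (y - (k + n)) = min m (u - k) + (v - (k + m))) :
    y = v ∧ ((x = u ∧ m = n) ∨ (x = u ∧ u = v) ∨ (x + m = v ∧ u + n = v)) := by
  have h0 := h 0
  have hy : y = v := by omega
  subst hy
  have h1 := h x
  have h2 := h (x - 1)
  have h3 := h (x + 1)
  have hd : x = u ∨ x + m = y := by omega
  refine ⟨rfl, ?_⟩
  rcases hd with hd | hd
  · have h4 := h (y - n)
    have h5 := h (y - n - 1)
    have h6 := h (y - n + 1)
    subst hd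
    omega
  · have : x = y - m := by omega
    have h7 := h u
    have h4 := h (y - n)
    clear h h0 h1 h2 h3
    refine Or.inr (Or.inr ⟨hd, ?_⟩)
    rcases Nat.lt_or_ge (y - n) u with g | g
    · omega
    · omega

lemma loc2 {m n y u v : ℕ} (hm : 0 < m) (hu : m < u) (huv : u ≤ v)
    (h : ∀ k, min n (0 - k) + (y - (k + n)) = min m (u - k) + (v - (k + m))) :
    u = v ∧ y = v + n := by
  have h0 := h 0
  have h1 := h u
  omega

lemma loc3 {m n x y v : ℕ} (hn : 0 < n) (hx : n < x) (hxy : x ≤ y) (hv : m < v)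
    (h : ∀ k, min n (x - k) + (y - (k + n)) = min m (0 - k) + (v - (k + m))) :
    y = x ∧ y + m = v := by
  have h0 := h 0
  have h1 := h x
  omega

/-- The shape `ell`. -/
def ell (a b P R x : ℕ) : ℕ := if x < b then R else if x < a then P else 0

lemma comb {a b c d m n P R : ℕ} {f : ℕ → ℕ} (hb : 0 < b) (hba : b < a) (hP : 0 < P) (hPR : P < R)
    (hcm : c = 0 ↔ m = 0) (hdn : d = 0 ↔ n = 0) (hca : c < a) (hda : d < a) (hmP : m < P)
    (hf : Antitone f) (hfa : ∀ t, f t = 0 ↔ a ≤ t)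
    (h : ∀ k t, min n (f (d + t) - k) + (f t - (k + n)) =
      min m (ell a b P R (c + t) - k) + (ell a b P R t - (k + m))) :
    (n = m ∧ d = c ∧ ∀ t, f t = ell a b P R t) ∨
    (n + P = R ∧ d + b = a ∧ ∀ t, f t = if t + c < a then R else if t < a then R - m else 0) ∨
    (d = c ∧ n + P = R ∧ 0 < n ∧ n < m ∧ a < b + c ∧ b ≤ c ∧
      ∀ t, f t = if t + c < a then R else if t < b then R - m + n else if t < a then P - m + n else 0) ∨
    (d + b = a ∧ n = m ∧ 0 < n ∧ m + P < R ∧ b ≤ c ∧ b + c < a ∧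
      ∀ t, f t = if t < b then R else if t + c < a then P + m else if t < a then P else 0) := by
  have l1 : ∀ t, t < b → ell a b P R t = R := fun t ht => by simp [ell, ht]
  have l2 : ∀ t, b ≤ t → t < a → ell a b P R t = P := fun t ht h2 => by
    simp [ell, not_lt.mpr ht, h2]
  have l3 : ∀ t, a ≤ t → ell a b P R t = 0 := fun t ht => by
    unfold ell; rw [if_neg (by omega), if_neg (by omega)]
  have l4 : ∀ t, t < a → P ≤ ell a b P R t := fun t ht => by
    unfold ell; split_ifs <;> omega
  have l5 : ∀ s t, s ≤ t → ell a b P R t ≤ ell a b P R s := fun s t ht => by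
    unfold ell; split_ifs <;> omega
  have f0 : ∀ t, a ≤ t → f t = 0 := fun t ht => (hfa t).mpr ht
  rcases Nat.eq_zero_or_pos m with hm | hm
  · have hc : c = 0 := hcm.mpr hm
    subst hm hc
    rcases Nat.eq_zero_or_pos n with hn | hn
    · have hd : d = 0 := hdn.mpr hn
      subst hn hd
      left
      refine ⟨rfl, rfl, fun t => ?_⟩
      have := h 0 t
      omega
    · have hd : 0 < d := by omega
      have s1 : ∀ t, a ≤ d + t → t < a → f t = ell a b P R t + n := by
        intro t h1 h2
        have := h 0 t
        have := f0 _ h1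
        have := l4 t h2
        omega
      have base : f (a - 1) = P + n := by
        rw [s1 _ (by omega) (by omega), l2 _ (by omega) (by omega)]
      have s2 : ∀ t, d + t < a → f (d + t) = ell a b P R t ∧ f t = ell a b P R t := by
        intro t h1
        have a1 := hf (show d + t ≤ a - 1 by omega)
        have a2 := hf (show t ≤ d + t by omega)
        have a3 := h 0 t
        have a4 := h (f (d + t)) t
        omega
      have j1 := s2 (a - d - 1) (by omega)
      have j2 := s1 (a - d) (by omega) (by omega)
      have j3 := hf (show a - d - 1 ≤ a - d by omega)
      have hbd : d + b = a := by
        unfold ell at j1 j2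
        split_ifs at j1 j2 <;> omega
      have j4 := (s2 (b - 1) (by omega)).1
      rw [show d + (b - 1) = a - 1 by omega, base, l1 _ (by omega)] at j4
      right; left
      refine ⟨by omega, hbd, fun t => ?_⟩
      split_ifs with g1
      · by_cases g2 : t < b
        · rw [(s2 t (by omega)).2, l1 _ g2]
        · rw [s1 t (by omega) (by omega), l2 _ (by omega) (by omega)]; omega
      · omega
      · exact f0 _ (by omega)
  have hc : 0 < c := by omega
  rcases Nat.eq_zero_or_pos n with hn | hn
  · exfalso
    have hd : d = 0 := hdn.mpr hn
    subst hn hd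
    have s1 : ∀ t, c + t < a → ell a b P R t = ell a b P R (c + t) := by
      intro t h1
      have a1 := l4 _ h1
      have a2 := l5 t (c + t) (by omega)
      have a3 := h 0 t
      have a4 := h (ell a b P R (c + t)) t
      omega
    have j1 := s1 (a - c - 1) (by omega)
    rw [l2 (c + (a - c - 1)) (by omega) (by omega)] at j1
    have hb' : b ≤ a - c - 1 := by
      by_contra hh
      rw [l1 _ (by omega)] at j1
      omega
    have j2 := s1 (b - 1) (by omega)
    rw [l1 _ (by omega), l2 _ (by omega) (by omega)] at j2
    omega
  have hd : 0 < d := by omega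
  have R1 : ∀ t, t < a → a ≤ d + t → a ≤ c + t → f t + m = ell a b P R t + n := by
    intro t h1 h2 h3
    have a0 := h 0 t
    rw [f0 _ h2, l3 _ h3] at a0
    have := l4 t h1
    omega
  have base : f (a - 1) + m = P + n := by
    have := R1 (a - 1) (by omega) (by omega) (by omega)
    rwa [l2 _ (by omega) (by omega)] at this
  have lo : ∀ t, t < a → P + n ≤ f t + m := by
    intro t ht
    have := hf (show t ≤ a - 1 by omega)
    omega
  have R2 : ∀ t, a ≤ d + t → c + t < a → ell a b P R (c + t) = ell a b P R t ∧
      f t = ell a b P R t + n := by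
    intro t h1 h2
    have a1 := fun k => h k t
    rw [f0 _ h1] at a1
    exact loc2 hm (lt_of_lt_of_le hmP (l4 _ h2)) (l5 _ _ (by omega)) a1
  have R3 : ∀ t, t < a → d + t < a → a ≤ c + t → f t = f (d + t) ∧ f t + m = ell a b P R t := by
    intro t h0 h1 h2
    have a1 := fun k => h k t
    rw [l3 _ h2] at a1
    have := lo _ h1
    exact loc3 hn (by omega) (hf (by omega)) (lt_of_lt_of_le hmP (l4 _ h0)) a1
  have R4 : ∀ t, d + t < a → c + t < a → f t = ell a b P R t ∧
      ((f (d + t) = ell a b P R (c + t) ∧ m = n) ∨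
        (f (d + t) = ell a b P R (c + t) ∧ ell a b P R (c + t) = ell a b P R t) ∨
        (f (d + t) + m = ell a b P R t ∧ ell a b P R (c + t) + n = ell a b P R t)) := by
    intro t h1 h2
    have := lo _ h1
    exact loc4 hm hn (by omega) (hf (by omega)) (lt_of_lt_of_le hmP (l4 _ h2))
      (l5 _ _ (by omega)) fun k => h k t
  rcases lt_trichotomy c d with hcd | hcd | hcd
  · have j1 := (R4 (a - d - 1) (by omega) (by omega)).1
    have j2 := (R2 (a - d) (by omega) (by omega)).2
    have j3 := hf (show a - d - 1 ≤ a - d by omega)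
    have hbd : d + b = a ∧ n + P ≤ R := by
      unfold ell at j1 j2
      split_ifs at j1 j2 <;> omega
    obtain ⟨hbd, hnR⟩ := hbd
    rcases hnR.eq_or_lt with hnR | hnR
    · right; left
      refine ⟨hnR, hbd, fun t => ?_⟩
      split_ifs with g1 g2
      · by_cases g3 : t < b
        · rw [(R4 t (by omega) (by omega)).1, l1 _ g3]
        · rw [(R2 t (by omega) (by omega)).2, l2 _ (by omega) (by omega)]; omega
      · have := R1 t g2 (by omega) (by omega)
        rw [l2 _ (by omega) (by omega)] at this
        omega
      · exact f0 _ (by omega)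
    · have k1 := (R4 (b - 1) (by omega) (by omega)).2
      rw [l1 (b - 1) (by omega), l2 (c + (b - 1)) (by omega) (by omega),
        show d + (b - 1) = a - 1 by omega] at k1
      have hmn : n = m := by omega
      have hbc : b ≤ c := by
        by_contra hbc
        have k2 := (R4 (b - 1 - c) (by omega) (by omega)).2
        have k3 := (R2 (d + (b - 1 - c)) (by omega) (by omega)).2
        rw [k3, l1 (b - 1 - c) (by omega), l1 (c + (b - 1 - c)) (by omega),
          l2 _ (by omega) (by omega)] at k2
        omega
      right; right; right
      refine ⟨hbd, hmn, hn, by omega, hbc, by omega, fun t => ?_⟩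
      split_ifs with g1 g2 g3
      · rw [(R4 t (by omega) (by omega)).1, l1 _ g1]
      · rw [(R2 t (by omega) (by omega)).2, l2 _ (by omega) (by omega)]; omega
      · have := R1 t g3 (by omega) (by omega)
        rw [l2 _ (by omega) (by omega)] at this
        omega
      · exact f0 _ (by omega)
  · subst hcd
    by_cases hmn : n = m
    · left
      refine ⟨hmn, rfl, fun t => ?_⟩
      by_cases g1 : c + t < a
      · exact (R4 t g1 g1).1
      · by_cases g2 : t < a
        · have := R1 t g2 (by omega) (by omega)
          omega
        · rw [f0 _ (by omega), l3 _ (by omega)]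
    · have k1 := R4 (a - c - 1) (by omega) (by omega)
      rw [show c + (a - c - 1) = a - 1 by omega, l2 (a - 1) (by omega) (by omega)] at k1
      have hac : a - c ≤ b := by
        by_contra hh
        rw [l2 (a - c - 1) (by omega) (by omega)] at k1
        omega
      rw [l1 (a - c - 1) (by omega)] at k1
      have hnR : n + P = R := by omega
      rcases hac.eq_or_lt with hac | hac
      · right; left
        refine ⟨hnR, by omega, fun t => ?_⟩
        split_ifs with g1 g2
        · rw [(R4 t (by omega) (by omega)).1, l1 _ (by omega)]
        · have := R1 t g2 (by omega) (by omega)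
          rw [l2 _ (by omega) (by omega)] at this
          omega
        · exact f0 _ (by omega)
      · have k2 := R1 (a - c) (by omega) (by omega) (by omega)
        rw [l1 _ (by omega)] at k2
        have k3 := hf (show a - c - 1 ≤ a - c by omega)
        have hbc : b ≤ c := by
          by_contra hbc
          have k4 := (R4 (b - 1 - c) (by omega) (by omega)).2
          have k5 := R1 (b - 1) (by omega) (by omega) (by omega)
          rw [l1 (b - 1) (by omega)] at k5
          rw [show c + (b - 1 - c) = b - 1 by omega, l1 (b - 1) (by omega),
            l1 (b - 1 - c) (by omega)] at k4
          omega
        right; right; left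
        refine ⟨rfl, hnR, hn, by omega, by omega, hbc, fun t => ?_⟩
        split_ifs with g1 g2 g3
        · rw [(R4 t (by omega) (by omega)).1, l1 _ (by omega)]
        · have := R1 t (by omega) (by omega) (by omega)
          rw [l1 _ (by omega)] at this
          omega
        · have := R1 t (by omega) (by omega) (by omega)
          rw [l2 _ (by omega) (by omega)] at this
          omega
        · exact f0 _ (by omega)
  · have j1 := R3 (a - d - 1) (by omega) (by omega) (by omega)
    have j2 := R1 (a - d) (by omega) (by omega) (by omega)
    have j3 := hf (show a - d - 1 ≤ a - d by omega)
    have hbd : d + b = a := by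
      have j1' := j1.2
      unfold ell at j1' j2
      split_ifs at j1' j2 <;> omega
    rw [show d + (a - d - 1) = a - 1 by omega, l1 _ (by omega)] at j1
    have hnR : n + P = R := by omega
    right; left
    refine ⟨hnR, hbd, fun t => ?_⟩
    split_ifs with g1 g2
    · rw [(R4 t (by omega) (by omega)).1, l1 _ (by omega)]
    · by_cases g3 : t < b
      · have := (R3 t (by omega) (by omega) (by omega)).2
        rw [l1 _ g3] at this
        omega
      · have := R1 t g2 (by omega) (by omega)
        rw [l2 _ (by omega) (by omega)] at this
        omega
    · exact f0 _ (by omega)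

lemma val_le {D : Finset (ℕ × ℕ)} {T : ℕ × ℕ → ℕ} (h : LRF D T) :
    ∀ v i j, (i, j) ∈ D → T (i, j) = v → v ≤ i + 1 := by
  intro v
  induction v with
  | zero => intros; omega
  | succ v ih =>
    intro i j hp hT
    rcases Nat.eq_zero_or_pos v with hv | hv
    · omega
    have h1 := h.lat i j (v - 1)
    rw [show v - 1 + 2 = v + 1 by omega, show v - 1 + 1 = v by omega] at h1
    have h2 : 0 < pcnt D T i j (v + 1) :=
      Finset.card_pos.mpr ⟨(i, j), by simp [hp, hT]⟩
    obtain ⟨⟨i', j'⟩, hq⟩ := Finset.card_pos.mp (lt_of_lt_of_le h2 h1)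
    simp only [Finset.mem_filter] at hq
    obtain ⟨q1, q2, q3⟩ := hq
    have := ih i' j' q1 q3
    rcases q2 with q2 | ⟨rfl, q2⟩
    · omega
    · have := h.row i' j j' hp q1 q2
      omega

lemma col_ge {D : Finset (ℕ × ℕ)} {T : ℕ × ℕ → ℕ} (h : LRF D T) {s j : ℕ} :
    ∀ i, s ≤ i → (∀ i', s ≤ i' → i' ≤ i → (i', j) ∈ D) → i - s + 1 ≤ T (i, j) := by
  intro i hi
  induction i, hi using Nat.le_induction with
  | base =>
    intro hD
    have := (h.supp _).mp (hD s le_rfl le_rfl)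
    omega
  | succ i hi ih =>
    intro hD
    have := ih fun i' h1 h2 => hD i' h1 (by omega)
    have := h.col i (i + 1) j (hD _ hi (by omega)) (hD _ (by omega) le_rfl) (by omega)
    omega

lemma rk_row {D : Finset (ℕ × ℕ)} {T : ℕ × ℕ → ℕ} (h : LRF D T) {i j j' : ℕ}
    (h1 : (i, j) ∈ D) (h2 : (i, j') ∈ D) (hj : j < j') : rk D T (i, j') < rk D T (i, j) := by
  have hle := h.row i j j' h1 h2 (by omega)
  have hpos := (h.supp _).mp h1
  have h3 : rk D T (i, j') ≤ pcnt D T i j' (T (i, j)) :=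
    lat_le h i j' (by omega) hle
  refine lt_of_le_of_lt h3 ?_
  unfold rk pcnt
  apply Finset.card_lt_card
  rw [Finset.ssubset_iff_of_subset]
  · refine ⟨(i, j), ?_, ?_⟩
    · simp [h1]
    · simp; omega
  · intro x hx
    simp only [Finset.mem_filter] at hx ⊢
    refine ⟨hx.1, ?_, hx.2.2⟩
    omega

lemma rk_pos {D : Finset (ℕ × ℕ)} {T : ℕ × ℕ → ℕ} {p : ℕ × ℕ} (h : p ∈ D) : 1 ≤ rk D T p :=
  Finset.card_pos.mpr ⟨p, by simp [h]⟩

lemma row_ge {D : Finset (ℕ × ℕ)} {T : ℕ × ℕ → ℕ} (h : LRF D T) {i : ℕ} :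
    ∀ s j, (∀ j', j ≤ j' → j' < j + s → (i, j') ∈ D) → s ≤ rk D T (i, j) := by
  intro s
  induction s with
  | zero => intros; omega
  | succ s ih =>
    intro j hD
    have h0 := hD j le_rfl (by omega)
    rcases Nat.eq_zero_or_pos s with hs | hs
    · subst hs; exact rk_pos h0
    · have := ih (j + 1) fun j' h1 h2 => hD j' (by omega) (by omega)
      have := rk_row h h0 (hD (j + 1) (by omega) (by omega)) (by omega)
      omega

lemma exists_rk (D : Finset (ℕ × ℕ)) (T : ℕ × ℕ → ℕ) {v s : ℕ} (h1 : 1 ≤ s)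
    (h2 : s ≤ cnt D T v) : ∃ p ∈ D, T p = v ∧ rk D T p = s := by
  have := Finset.surj_on_of_inj_on_of_card_le (s := D.filter fun p => T p = v)
    (t := Finset.Icc 1 (cnt D T v)) (fun p _ => rk D T p) ?_ ?_ ?_ s ?_
  · obtain ⟨p, hp, hs⟩ := this
    rw [Finset.mem_filter] at hp
    exact ⟨p, hp.1, hp.2, hs.symm⟩
  · intro p hp
    rw [Finset.mem_filter] at hp
    rw [Finset.mem_Icc]
    have := rk_le_cnt D T p
    rw [hp.2] at this
    exact ⟨rk_pos hp.1, this⟩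
  · intro p q hp hq he
    rw [Finset.mem_filter] at hp hq
    exact rk_inj hp.1 hq.1 (hp.2.trans hq.2.symm) he
  · rw [Nat.card_Icc]
    unfold cnt
    omega
  · rw [Finset.mem_Icc]; omega

lemma card_le_eq {D D' : Finset (ℕ × ℕ)} {T T' : ℕ × ℕ → ℕ} (h : LRF D T) (h' : LRF D' T')
    (he : ∀ k, cnt D T (k + 1) = cnt D' T' (k + 1)) (N : ℕ) :
    (D.filter fun p => T p ≤ N).card = (D'.filter fun p => T' p ≤ N).card := by
  have key : ∀ (D : Finset (ℕ × ℕ)) (T : ℕ × ℕ → ℕ), LRF D T →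
      (D.filter fun p => T p ≤ N).card = ∑ v ∈ Finset.range N, cnt D T (v + 1) := by
    intro D T h
    rw [Finset.card_eq_sum_card_fiberwise (f := fun p => T p - 1) (t := Finset.range N)]
    · apply Finset.sum_congr rfl
      intro v hv
      rw [Finset.mem_range] at hv
      unfold cnt
      congr 1
      ext p
      simp only [Finset.mem_filter]
      have := h.supp p
      constructor
      · rintro ⟨⟨a, b⟩, c⟩
        have := this.mp a
        exact ⟨a, by omega⟩
      · rintro ⟨a, b⟩
        exact ⟨⟨a, by omega⟩, by omega⟩
    · intro p hp
      simp only [Finset.coe_filter, Set.mem_ofPred_eq, Finset.coe_range, Set.mem_Iio] at hp ⊢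
      have := (h.supp p).mp hp.1
      omega
  rw [key D T h, key D' T' h']
  exact Finset.sum_congr rfl fun v _ => he v

lemma le_cnt {D : Finset (ℕ × ℕ)} {T : ℕ × ℕ → ℕ} {v N : ℕ} (g : ℕ → ℕ × ℕ)
    (h1 : ∀ s < N, g s ∈ D ∧ T (g s) = v) (h2 : ∀ s < N, ∀ s' < N, g s = g s' → s = s') :
    N ≤ cnt D T v := by
  unfold cnt
  conv_lhs => rw [← Finset.card_range N]
  apply Finset.card_le_card_of_injOn g
  · intro s hs
    simp only [Finset.coe_range, Set.mem_Iio] at hs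
    simpa using h1 s hs
  · intro s hs s' hs' he
    simp only [Finset.coe_range, Set.mem_Iio] at hs hs'
    exact h2 s hs s' hs' he

section exceptional

variable {n m k w b c : ℕ}

/-- The common exceptional partner. -/
def inB (n m k w b c i j : ℕ) : Prop :=
  (i < n ∧ c ≤ j ∧ j < c + w) ∨ (n ≤ i ∧ i < n + k ∧ j < c + w) ∨
  (n + k ≤ i ∧ i < 2 * n + k ∧ j < b) ∨ (2 * n + k ≤ i ∧ i < n + k + m ∧ j < w)

def inA1 (n m k w b c i j : ℕ) : Prop :=
  (i < m ∧ c ≤ j ∧ j < c + w) ∨ (m ≤ i ∧ i < m + k ∧ j < c + w) ∨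
  (m + k ≤ i ∧ i < m + k + n ∧ j < b)

def inA2 (n m k w b c i j : ℕ) : Prop :=
  (i < n ∧ c + w ≤ j + b ∧ j < c + w) ∨ (n ≤ i ∧ i < n + k ∧ j < c + w) ∨
  (n + k ≤ i ∧ i < n + k + m ∧ j < w)

noncomputable def tB (n m k w b c : ℕ) (p : ℕ × ℕ) : ℕ :=
  if inB n m k w b c p.1 p.2 then
    if p.1 + 1 = 2 * n + k ∧ p.2 + 1 = b then n + k + 1
    else if p.2 < c then p.1 - n + 1 else p.1 + 1
  else 0

lemma tB_LRF (hn : 0 < n) (hnm : n < m) (hk : 0 < k) (hw : 0 < w) (hwb : w < b) (hbc : b ≤ c)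
    {D : Finset (ℕ × ℕ)} (hD : ∀ i j, (i, j) ∈ D ↔ inB n m k w b c i j) :
    LRF D (tB n m k w b c) := by
  refine ⟨?_, ?_, ?_, ?_⟩
  · rintro ⟨i, j⟩
    rw [hD]
    unfold tB
    simp only
    split_ifs <;> simp_all
  · intro i j1 j2 h1 h2 hle
    rw [hD] at h1 h2
    unfold tB
    simp only [h1, h2, if_true]
    unfold inB at h1 h2
    split_ifs <;> omega
  · intro i1 i2 j h1 h2 hlt
    rw [hD] at h1 h2
    unfold tB
    simp only [h1, h2, if_true]
    unfold inB at h1 h2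
    split_ifs <;> omega
  · apply lat_of_inj fun p => if p.1 + 1 = 2 * n + k ∧ p.2 + 1 = b then (n + k - 1, c + w - 1)
      else (p.1 - 1, p.2)
    · rintro ⟨i, j⟩ hp h2
      rw [hD] at hp
      simp only
      by_cases hc : i + 1 = 2 * n + k ∧ j + 1 = b
      · rw [if_pos hc]
        have hq : inB n m k w b c (n + k - 1) (c + w - 1) := by
          unfold inB; omega
        rw [hD]
        refine ⟨hq, ?_, ?_⟩
        · unfold tB
          simp only [hp, hq, hc, if_true, true_and]
          unfold inB at hp
          rw [if_neg (by omega), if_neg (by omega)]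
          omega
        · simp only; omega
      · rw [if_neg hc]
        have hi : 0 < i ∧ (j < c → n < i) := by
          unfold tB at h2
          simp only [hp, if_true, hc, if_false] at h2
          unfold inB at hp
          split_ifs at h2 <;> omega
        have hq : inB n m k w b c (i - 1) j := by
          unfold inB at hp ⊢; omega
        rw [hD]
        refine ⟨hq, ?_, ?_⟩
        · unfold tB
          simp only [hp, hq, hc, if_true, if_false]
          unfold inB at hp hq
          split_ifs <;> omega
        · simp only; omega
    · rintro ⟨i, j⟩ hp ⟨i', j'⟩ hq h2 he hf
      rw [hD] at hp hq
      unfold tB at h2 he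
      simp only [hp, hq, if_true] at h2 he hf
      rw [Prod.mk.injEq]
      unfold inB at hp hq
      split_ifs at h2 he hf <;> (rw [Prod.mk.injEq] at hf; omega)

lemma tB_cnt (hn : 0 < n) (hnm : n < m) (hk : 0 < k) (hw : 0 < w) (hwb : w < b) (hbc : b ≤ c)
    {D : Finset (ℕ × ℕ)} (hD : ∀ i j, (i, j) ∈ D ↔ inB n m k w b c i j) :
    w + 1 ≤ cnt D (tB n m k w b c) (n + k + 1) := by
  apply le_cnt fun s => if s < w then (2 * n + k, s) else (2 * n + k - 1, b - 1)
  · intro s hs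
    split_ifs with h
    · have : inB n m k w b c (2 * n + k) s := by unfold inB; omega
      rw [hD]
      refine ⟨this, ?_⟩
      unfold tB
      simp only [this, if_true]
      rw [if_neg (by omega), if_pos (by omega)]
      omega
    · have : inB n m k w b c (2 * n + k - 1) (b - 1) := by unfold inB; omega
      rw [hD]
      refine ⟨this, ?_⟩
      unfold tB
      simp only [this, if_true]
      rw [if_pos (by omega)]
  · intro s hs s' hs' he
    split_ifs at he <;> (rw [Prod.mk.injEq] at he; omega)

lemma no_A2 (hn : 0 < n) (hnm : n < m) (hk : 0 < k) (hw : 0 < w) (hwb : w < b) (hbc : b ≤ c)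
    {D D' : Finset (ℕ × ℕ)} (hD : ∀ i j, (i, j) ∈ D ↔ inB n m k w b c i j)
    (hD' : ∀ i j, (i, j) ∈ D' ↔ inA2 n m k w b c i j) : ¬ Tr D D' := by
  intro h
  obtain ⟨T, h1, h2⟩ := h _ (tB_LRF hn hnm hk hw hwb hbc hD)
  have h3 := tB_cnt hn hnm hk hw hwb hbc hD
  rw [h2] at h3
  have h4 : cnt D' T (n + k + 1) ≤ w := by
    unfold cnt
    conv_rhs => rw [← Finset.card_range w]
    apply Finset.card_le_card_of_injOn Prod.snd
    · rintro ⟨i, j⟩ hp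
      simp only [Finset.mem_coe, Finset.mem_filter, Finset.mem_range] at hp ⊢
      have := val_le h1 _ i j hp.1 hp.2
      have hp1 := (hD' _ _).mp hp.1
      unfold inA2 at hp1
      omega
    · rintro ⟨i, j⟩ hp ⟨i', j'⟩ hq he
      simp only [Finset.mem_coe, Finset.mem_filter] at hp hq he
      subst he
      rcases lt_trichotomy i i' with g | g | g
      · have := h1.col _ _ _ hp.1 hq.1 g; omega
      · rw [g]
      · have := h1.col _ _ _ hq.1 hp.1 g; omega
  omega

lemma no_A1 (hn : 0 < n) (hnm : n < m) (hk : 0 < k) (hw : 0 < w) (hwb : w < b) (hbc : b ≤ c)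
    {D D' : Finset (ℕ × ℕ)} (hD : ∀ i j, (i, j) ∈ D ↔ inB n m k w b c i j)
    (hD' : ∀ i j, (i, j) ∈ D' ↔ inA1 n m k w b c i j) : ¬ Tr D D' := by
  intro h
  have h0 := tB_LRF hn hnm hk hw hwb hbc hD
  obtain ⟨T, h1, h2⟩ := h _ h0
  have h3 := tB_cnt hn hnm hk hw hwb hbc hD
  rw [h2] at h3
  -- the columns at the right are forced
  have forced : ∀ i j, c ≤ j → (i, j) ∈ D' → T (i, j) = i + 1 := by
    intro i j hj hp
    have a1 := val_le h1 _ i j hp rfl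
    have a2 := col_ge h1 (s := 0) (j := j) i (by omega) (by
      intro i' _ hi'
      rw [hD'] at hp ⊢
      unfold inA1 at hp ⊢
      omega)
    omega
  -- shallow cells have small entries
  have shallow : ∀ i j, j < c → (i, j) ∈ D' → i + 1 < m + k + n → T (i, j) ≤ n + k - 1 := by
    have hcard := card_le_eq h0 h1 h2 (n + k - 1)
    have hsub : (D'.filter fun p => T p ≤ n + k - 1) ⊆
        D'.filter fun p => (p.2 < c ∧ p.1 + 1 < m + k + n) ∨ (c ≤ p.2 ∧ p.1 + 1 < n + k) := by
      rintro ⟨i, j⟩ hp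
      simp only [Finset.mem_filter] at hp ⊢
      refine ⟨hp.1, ?_⟩
      by_cases hj : j < c
      · left
        have hp1 := (hD' _ _).mp hp.1
        have := col_ge h1 (s := m) (j := j) i (by unfold inA1 at hp1; omega) (by
          intro i' _ hi'
          rw [hD']
          unfold inA1 at hp1 ⊢
          omega)
        omega
      · right
        have := forced i j (by omega) hp.1
        omega
    have hle : (D'.filter fun p => (p.2 < c ∧ p.1 + 1 < m + k + n) ∨
        (c ≤ p.2 ∧ p.1 + 1 < n + k)).card ≤
        (D.filter fun p => tB n m k w b c p ≤ n + k - 1).card := by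
      apply Finset.card_le_card_of_injOn fun p => if p.2 < c then (p.1 - m + n, p.2) else p
      · rintro ⟨i, j⟩ hp
        simp only [Finset.mem_filter, Finset.mem_coe] at hp ⊢
        have hp1 := (hD' _ _).mp hp.1
        by_cases hj : j < c
        · rw [if_pos hj, hD]
          have hq : inB n m k w b c (i - m + n) j := by
            unfold inA1 at hp1; unfold inB; omega
          refine ⟨hq, ?_⟩
          unfold tB
          simp only [hq, if_true, hj]
          unfold inA1 at hp1
          split_ifs <;> omega
        · rw [if_neg hj, hD]
          have hq : inB n m k w b c i j := by
            unfold inA1 at hp1; unfold inB; omega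
          refine ⟨hq, ?_⟩
          unfold tB
          simp only [hq, if_true, hj, if_false]
          unfold inA1 at hp1
          split_ifs <;> omega
      · rintro ⟨i, j⟩ hp ⟨i', j'⟩ hq he
        simp only [Finset.mem_filter, Finset.mem_coe] at hp hq he
        have hp1 := (hD' _ _).mp hp.1
        have hq1 := (hD' _ _).mp hq.1
        unfold inA1 at hp1 hq1
        rw [Prod.mk.injEq]
        split_ifs at he <;> (rw [Prod.mk.injEq] at he; omega)
    have heq := Finset.eq_of_subset_of_card_le hsub (by omega)
    intro i j hj hp hi
    have : (i, j) ∈ D'.filter fun p => T p ≤ n + k - 1 := by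
      rw [heq]
      simp only [Finset.mem_filter]
      exact ⟨hp, Or.inl ⟨hj, hi⟩⟩
    exact (Finset.mem_filter.mp this).2
  -- an extra entry `n + k + 1`
  have hbnd : ∀ (r : ℕ) (S : Finset (ℕ × ℕ)), (∀ p ∈ S, p ∈ D' ∧ T p = r + 1 ∧ c ≤ p.2) →
      S.card ≤ w := by
    intro r S hS
    conv_rhs => rw [← Finset.card_range w]
    apply Finset.card_le_card_of_injOn fun p => p.2 - c
    · rintro ⟨i, j⟩ hp
      obtain ⟨a1, a2, a3⟩ := hS _ hp
      simp only [Finset.coe_range, Set.mem_Iio] at a3 ⊢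
      rw [hD'] at a1
      unfold inA1 at a1
      omega
    · rintro ⟨i, j⟩ hp ⟨i', j'⟩ hq he
      obtain ⟨a1, a2, a3⟩ := hS _ hp
      obtain ⟨b1, b2, b3⟩ := hS _ hq
      simp only at he a3 b3
      have := forced _ _ a3 a1
      have := forced _ _ b3 b1
      rw [Prod.mk.injEq]
      omega
  obtain ⟨i, j, hp, hT, hj⟩ : ∃ i j, (i, j) ∈ D' ∧ T (i, j) = n + k + 1 ∧ j < c := by
    by_contra hcon
    push Not at hcon
    have := hbnd (n + k) (D'.filter fun p => T p = n + k + 1) (by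
      rintro ⟨i, j⟩ hp
      rw [Finset.mem_filter] at hp
      exact ⟨hp.1, hp.2, hcon i j hp.1 hp.2⟩)
    unfold cnt at h3
    omega
  have hi := val_le h1 _ i j hp hT
  have hpc : w + 1 ≤ pcnt D' T i j (n + k + 1) := by
    unfold pcnt
    conv_lhs => rw [← Finset.card_range (w + 1)]
    apply Finset.card_le_card_of_injOn fun s => if s < w then (n + k, c + s) else (i, j)
    · intro s hs
      simp only [Finset.coe_range, Set.mem_Iio] at hs
      simp only [Finset.mem_filter, Finset.mem_coe]
      split_ifs with g
      · have hm : (n + k, c + s) ∈ D' := by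
          rw [hD']; unfold inA1; omega
        refine ⟨hm, ?_, forced _ _ (by omega) hm⟩
        simp only; omega
      · exact ⟨hp, Or.inr ⟨rfl, le_rfl⟩, hT⟩
    · intro s hs s' hs' he
      simp only [Finset.coe_range, Set.mem_Iio] at hs hs' he
      split_ifs at he with g1 g2 g2 <;> (try rw [Prod.mk.injEq] at he) <;> omega
  have hlat := h1.lat i j (n + k - 1)
  rw [show n + k - 1 + 2 = n + k + 1 by omega, show n + k - 1 + 1 = n + k by omega] at hlat
  obtain ⟨i', j', hq, hq2, hqT, hqj⟩ : ∃ i' j', (i', j') ∈ D' ∧ (i' < i ∨ (i' = i ∧ j ≤ j')) ∧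
      T (i', j') = n + k ∧ j' < c := by
    by_contra hcon
    push Not at hcon
    have := hbnd (n + k - 1) (D'.filter fun p => (p.1 < i ∨ (p.1 = i ∧ j ≤ p.2)) ∧ T p = n + k) (by
      rintro ⟨i', j'⟩ hp
      rw [Finset.mem_filter] at hp
      refine ⟨hp.1, by omega, hcon i' j' hp.1 hp.2.1 hp.2.2⟩)
    unfold pcnt at hlat hpc
    omega
  have hi' : i' < i := by
    rcases hq2 with g | ⟨rfl, g⟩
    · exact g
    · have := h1.row _ _ _ hp hq g
      omega
  have hp1 := (hD' _ _).mp hp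
  have := shallow i' j' hqj hq (by unfold inA1 at hp1; omega)
  omega

end exceptional

section exceptional

variable {n m k w b c : ℕ}

noncomputable def tBT (n m k w b c : ℕ) (p : ℕ × ℕ) : ℕ :=
  if inB n m k w b c p.2 p.1 then
    if n ≤ p.2 then p.1 + 1
    else if 1 ≤ p.2 then p.1 + 1 - (c - b)
    else if p.1 = c then w + 1 else p.1 - (c - b)
  else 0

def fBT (n k w b c : ℕ) (p : ℕ × ℕ) : ℕ × ℕ :=
  if n ≤ p.2 then (p.1 - 1, p.2)
  else if 1 ≤ p.2 then (if p.1 = c then (b - 1, p.2 + n + k) else (p.1 - 1, p.2))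
  else if p.1 = c then (w - 1, 2 * n + k)
  else if p.1 = c + 1 then (b - 1, n + k) else (p.1 - 1, p.2)

lemma tBT_LRF (hn : 0 < n) (hnm : n < m) (hk : 0 < k) (hw : 0 < w) (hwb : w < b) (hbc : b ≤ c)
    {D : Finset (ℕ × ℕ)} (hD : ∀ i j, (i, j) ∈ D ↔ inB n m k w b c j i) :
    LRF D (tBT n m k w b c) := by
  refine ⟨?_, ?_, ?_, ?_⟩
  · rintro ⟨i, j⟩
    rw [hD]
    unfold tBT
    by_cases hc : inB n m k w b c j i
    · simp only [hc, if_true, true_iff]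
      unfold inB at hc
      split_ifs <;> omega
    · simp only [hc, if_false, false_iff]
      omega
  · intro i j1 j2 h1 h2 hle
    rw [hD] at h1 h2
    unfold tBT
    simp only [h1, h2, if_true]
    unfold inB at h1 h2
    split_ifs <;> omega
  · intro i1 i2 j h1 h2 hlt
    rw [hD] at h1 h2
    unfold tBT
    simp only [h1, h2, if_true]
    unfold inB at h1 h2
    split_ifs <;> omega
  · apply lat_of_inj (fBT n k w b c)
    · rintro ⟨i, j⟩ hp h2
      rw [hD] at hp
      unfold tBT at h2
      simp only [hp, if_true] at h2
      have main : ∀ i' j', inB n m k w b c j' i' →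
          ((if n ≤ j' then i' + 1 else if 1 ≤ j' then i' + 1 - (c - b)
            else if i' = c then w + 1 else i' - (c - b)) + 1 =
            (if n ≤ j then i + 1 else if 1 ≤ j then i + 1 - (c - b)
            else if i = c then w + 1 else i - (c - b))) → i' < i →
          (i', j') ∈ D ∧ tBT n m k w b c (i', j') + 1 = tBT n m k w b c (i, j) ∧
          ((i', j').1 < (i, j).1 ∨ ((i', j').1 = (i, j).1 ∧ (i, j).2 ≤ (i', j').2)) := by
        intro i' j' a1 a2 a3
        refine ⟨(hD _ _).mpr a1, ?_, Or.inl a3⟩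
        unfold tBT
        simp only [a1, hp, if_true]
        exact a2
      unfold fBT
      simp only
      split_ifs at h2 ⊢ with g1 g2 g3 g4 g5 <;>
        (apply main <;> [(unfold inB at hp ⊢; omega); (unfold inB at hp; split_ifs <;> omega);
          (unfold inB at hp; omega)])
    · rintro ⟨i, j⟩ hp ⟨i', j'⟩ hq h2 he hf
      rw [hD] at hp hq
      unfold tBT at h2 he
      unfold fBT at hf
      simp only [hp, hq, if_true] at h2 he hf
      rw [Prod.mk.injEq]
      unfold inB at hp hq
      split_ifs at h2 he hf <;> (rw [Prod.mk.injEq] at hf; omega)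

lemma tBT_cnt1 (hn : 0 < n) (hnm : n < m) (hw : 0 < w) (hwb : w < b) (hbc : b ≤ c)
    {D : Finset (ℕ × ℕ)} (hD : ∀ i j, (i, j) ∈ D ↔ inB n m k w b c j i) :
    n + k + 1 ≤ cnt D (tBT n m k w b c) (w + 1) := by
  apply le_cnt fun s => if s < n + k then (w, n + s) else (c, 0)
  · intro s hs
    split_ifs with h
    · have : inB n m k w b c (n + s) w := by unfold inB; omega
      rw [hD]
      refine ⟨this, ?_⟩
      unfold tBT
      simp only [this, if_true]
      rw [if_pos (by omega)]
    · have : inB n m k w b c 0 c := by unfold inB; omega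
      rw [hD]
      refine ⟨this, ?_⟩
      unfold tBT
      simp only [this, if_true]
      rw [if_neg (by omega), if_neg (by omega)]
  · intro s hs s' hs' he
    split_ifs at he <;> (rw [Prod.mk.injEq] at he; omega)

lemma tBT_cnt2 (hn : 0 < n) (hw : 0 < w) (hbc : b ≤ c)
    {D : Finset (ℕ × ℕ)} (hD : ∀ i j, (i, j) ∈ D ↔ inB n m k w b c j i) :
    n + k - 1 ≤ cnt D (tBT n m k w b c) (w + b) := by
  apply le_cnt fun s => if s < k then (b + w - 1, n + s) else (c + w - 1, s - k + 1)
  · intro s hs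
    split_ifs with h
    · have : inB n m k w b c (n + s) (b + w - 1) := by unfold inB; omega
      rw [hD]
      refine ⟨this, ?_⟩
      unfold tBT
      simp only [this, if_true]
      rw [if_pos (by omega)]
      omega
    · have : inB n m k w b c (s - k + 1) (c + w - 1) := by unfold inB; omega
      rw [hD]
      refine ⟨this, ?_⟩
      unfold tBT
      simp only [this, if_true]
      rw [if_neg (by omega), if_pos (by omega)]
      omega
  · intro s hs s' hs' he
    split_ifs at he <;> (rw [Prod.mk.injEq] at he; omega)

lemma tBT_cnt3 (hw : 0 < w)
    {D : Finset (ℕ × ℕ)} (hD : ∀ i j, (i, j) ∈ D ↔ inB n m k w b c j i) :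
    k ≤ cnt D (tBT n m k w b c) (c + w) := by
  apply le_cnt fun s => (c + w - 1, n + s)
  · intro s hs
    have : inB n m k w b c (n + s) (c + w - 1) := by unfold inB; omega
    rw [hD]
    refine ⟨this, ?_⟩
    unfold tBT
    simp only [this, if_true]
    rw [if_pos (by omega)]
    omega
  · intro s hs s' hs' he
    rw [Prod.mk.injEq] at he
    omega

lemma cnt_mono {D : Finset (ℕ × ℕ)} {T : ℕ × ℕ → ℕ} (h : LRF D T) {v v' : ℕ} (hv : 1 ≤ v)
    (hvv : v ≤ v') : cnt D T v' ≤ cnt D T v := by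
  have := cnt_antitone h (show v - 1 ≤ v' - 1 by omega)
  simp only at this
  rwa [show v' - 1 + 1 = v' by omega, show v - 1 + 1 = v by omega] at this

/-- A pigeonhole: `w + 1` cells of the same rank cannot all lie in `w` rows. -/
lemma pigeon {D : Finset (ℕ × ℕ)} {T : ℕ × ℕ → ℕ} (h : LRF D T) {s w r0 : ℕ} (hs : 1 ≤ s)
    (hc : s ≤ cnt D T (w + 1)) : ∃ p ∈ D, rk D T p = s ∧ ¬ (r0 ≤ p.1 ∧ p.1 < r0 + w) := by
  by_contra hcon
  push Not at hcon
  have hex : ∀ v, ∃ p, v < w + 1 → p ∈ D ∧ T p = v + 1 ∧ rk D T p = s := by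
    intro v
    by_cases hv : v < w + 1
    · obtain ⟨p, a1, a2, a3⟩ := exists_rk D T (v := v + 1) hs
        (hc.trans (cnt_mono h (by omega) (by omega)))
      exact ⟨p, fun _ => ⟨a1, a2, a3⟩⟩
    · exact ⟨(0, 0), fun hh => absurd hh hv⟩
  choose g hg using hex
  have : (Finset.range (w + 1)).card ≤ (Finset.Ico r0 (r0 + w)).card := by
    apply Finset.card_le_card_of_injOn fun v => (g v).1
    · intro v hv
      simp only [Finset.coe_range, Set.mem_Iio] at hv
      obtain ⟨a1, a2, a3⟩ := hg v hv
      have := hcon _ a1 a3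
      simp only [Finset.coe_Ico, Set.mem_Ico]
      exact this
    · intro v hv v' hv' he
      simp only [Finset.coe_range, Set.mem_Iio] at hv hv' he
      obtain ⟨a1, a2, a3⟩ := hg v hv
      obtain ⟨b1, b2, b3⟩ := hg v' hv'
      have key : ∀ p q : ℕ × ℕ, p ∈ D → q ∈ D → p.1 = q.1 → rk D T p = rk D T q → p = q := by
        rintro ⟨i, j⟩ ⟨i', j'⟩ hp hq hi hr
        simp only at hi
        subst hi
        rcases lt_trichotomy j j' with g | g | g
        · have := rk_row h hp hq g; omega
        · rw [g]
        · have := rk_row h hq hp g; omega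
      have := key _ _ a1 b1 he (a3.trans b3.symm)
      rw [this] at a2
      omega
  rw [Finset.card_range, Nat.card_Ico] at this
  omega

lemma no_A1T (hn : 0 < n) (hnm : n < m) (hk : 0 < k) (hw : 0 < w) (hwb : w < b) (hbc : b ≤ c)
    {D D' : Finset (ℕ × ℕ)} (hD : ∀ i j, (i, j) ∈ D ↔ inB n m k w b c j i)
    (hD' : ∀ i j, (i, j) ∈ D' ↔ inA1 n m k w b c j i) : ¬ Tr D D' := by
  intro h
  obtain ⟨T, h1, h2⟩ := h _ (tBT_LRF hn hnm hk hw hwb hbc hD)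
  have h3 := tBT_cnt1 hn hnm hw hwb hbc hD
  rw [h2] at h3
  obtain ⟨⟨i, j⟩, hp, hr, hi⟩ := pigeon h1 (r0 := c) (by omega) h3
  have hub : rk D' T (i, j) ≤ (Finset.Ico j (m + k + n)).card := by
    unfold rk pcnt
    apply Finset.card_le_card_of_injOn Prod.snd
    · rintro ⟨i', j'⟩ hq
      simp only [Finset.mem_filter, Finset.mem_coe] at hq
      simp only [Finset.coe_Ico, Set.mem_Ico]
      obtain ⟨q1, q2, q3⟩ := hq
      refine ⟨?_, ?_⟩
      · by_contra hlt
        have hi' : i' < i := by omega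
        have hm : (i', j) ∈ D' := by
          rw [hD'] at q1 hp ⊢
          unfold inA1 at q1 hp ⊢
          omega
        have := h1.row i' j' j q1 hm (by omega)
        have := h1.col i' i j hm hp hi'
        omega
      · rw [hD'] at q1
        unfold inA1 at q1
        omega
    · rintro ⟨i1, j1⟩ hq ⟨i2, j2⟩ hq' he
      simp only [Finset.mem_filter, Finset.mem_coe] at hq hq' he
      subst he
      rcases lt_trichotomy i1 i2 with g | g | g
      · have := h1.col _ _ _ hq.1 hq'.1 g; omega
      · rw [g]
      · have := h1.col _ _ _ hq'.1 hq.1 g; omega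
  rw [Nat.card_Ico] at hub
  rw [hD'] at hp
  unfold inA1 at hp
  simp only at hi
  omega

lemma no_A2T (hn : 0 < n) (hnm : n < m) (hk : 0 < k) (hw : 0 < w) (hwb : w < b) (hbc : b ≤ c)
    {D D' : Finset (ℕ × ℕ)} (hD : ∀ i j, (i, j) ∈ D ↔ inB n m k w b c j i)
    (hD' : ∀ i j, (i, j) ∈ D' ↔ inA2 n m k w b c j i) : ¬ Tr D D' := by
  intro h
  obtain ⟨T, h1, h2⟩ := h _ (tBT_LRF hn hnm hk hw hwb hbc hD)
  have c1 := tBT_cnt1 hn hnm hw hwb hbc hD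
  have c2 := tBT_cnt2 hn hw hbc hD
  have c3 := tBT_cnt3 hw hD
  rw [h2] at c1
  rw [show w + b = w + b - 1 + 1 by omega, h2, show w + b - 1 + 1 = w + b by omega] at c2
  rw [show c + w = c + w - 1 + 1 by omega, h2, show c + w - 1 + 1 = c + w by omega] at c3
  -- the length of rows and the positions
  have rkge : ∀ i j L, (i, j) ∈ D' → (i < w → L = n + k + m) → (w ≤ i → L = n + k) →
      L - j ≤ rk D' T (i, j) := by
    intro i j L hp hL1 hL2
    apply row_ge h1
    intro j' g1 g2
    rw [hD'] at hp ⊢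
    unfold inA2 at hp ⊢
    omega
  let L : ℕ → ℕ := fun i => if i < w then n + k + m else n + k
  have L1 : ∀ i, i < w → L i = n + k + m := fun i hi => if_pos hi
  have L2 : ∀ i, w ≤ i → L i = n + k := fun i hi => if_neg (by omega)
  let sg : ℕ → ℕ := fun i => if i < w then i + 1 else if i + b < c + w then i + b + 1
    else i + b + w + 1 - (c + w)
  have exr : ∀ p, ∃ q, p ∈ D' ∧ L p.1 - p.2 < n + k →
      q ∈ D' ∧ T q = sg p.1 ∧ rk D' T q = L p.1 - p.2 := by
    rintro ⟨i, j⟩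
    by_cases hp : (i, j) ∈ D' ∧ L i - j < n + k
    · obtain ⟨hp, hl⟩ := hp
      have hp1 := (hD' _ _).mp hp
      unfold inA2 at hp1
      have : 1 ≤ L i - j ∧ L i - j ≤ cnt D' T (sg i) := by
        by_cases g1 : i < w
        · rw [L1 i g1] at hl ⊢
          have e : sg i = i + 1 := if_pos g1
          rw [e]
          have := cnt_mono h1 (show 1 ≤ i + 1 by omega) (show i + 1 ≤ w + b by omega)
          omega
        · rw [L2 i (by omega)] at hl ⊢
          by_cases g2 : i + b < c + w
          · have e : sg i = i + b + 1 := by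
              change (if _ then _ else _) = _
              rw [if_neg g1, if_pos g2]
            rw [e]
            have := cnt_mono h1 (show 1 ≤ i + b + 1 by omega) (show i + b + 1 ≤ c + w by omega)
            omega
          · have e : sg i = i + b + w + 1 - (c + w) := by
              change (if _ then _ else _) = _
              rw [if_neg g1, if_neg g2]
            rw [e]
            have := cnt_mono h1 (show 1 ≤ i + b + w + 1 - (c + w) by omega)
              (show i + b + w + 1 - (c + w) ≤ w + b by omega)
            omega
      obtain ⟨q, a1, a2, a3⟩ := exists_rk D' T this.1 this.2
      exact ⟨q, fun _ => ⟨a1, a2, a3⟩⟩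
    · exact ⟨(0, 0), fun hh => absurd hh hp⟩
  choose g hg using exr
  -- cells of small position have small rank
  have small : ∀ p ∈ D', L p.1 - p.2 < n + k → rk D' T p < n + k := by
    have hsub : (D'.filter fun p => rk D' T p < n + k) ⊆ D'.filter fun p => L p.1 - p.2 < n + k := by
      rintro ⟨i, j⟩ hp
      rw [Finset.mem_filter] at hp ⊢
      have := rkge i j (L i) hp.1 (L1 i) (L2 i)
      exact ⟨hp.1, lt_of_le_of_lt this hp.2⟩
    have hle : (D'.filter fun p => L p.1 - p.2 < n + k).card ≤
        (D'.filter fun p => rk D' T p < n + k).card := by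
      apply Finset.card_le_card_of_injOn g
      · intro p hp
        simp only [Finset.mem_coe, Finset.mem_filter] at hp ⊢
        obtain ⟨a1, a2, a3⟩ := hg p hp
        exact ⟨a1, by rw [a3]; exact hp.2⟩
      · rintro ⟨i, j⟩ hp ⟨i', j'⟩ hq he
        simp only [Finset.mem_coe, Finset.mem_filter] at hp hq
        obtain ⟨a1, a2, a3⟩ := hg _ hp
        obtain ⟨b1, b2, b3⟩ := hg _ hq
        rw [he] at a2 a3
        have e1 : sg i = sg i' := a2.symm.trans b2
        have e2 : L i - j = L i' - j' := a3.symm.trans b3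
        have hp1 := (hD' _ _).mp hp.1
        have hq1 := (hD' _ _).mp hq.1
        unfold inA2 at hp1 hq1
        have hii : i = i' := by
          simp only [sg] at e1
          split_ifs at e1 <;> omega
        subst hii
        have : j < L i ∧ j' < L i := by
          simp only [L]
          split_ifs <;> omega
        rw [Prod.mk.injEq]
        omega
    have heq := Finset.eq_of_subset_of_card_le hsub hle
    intro p hp hl
    have : p ∈ D'.filter fun p => rk D' T p < n + k := by
      rw [heq]
      exact Finset.mem_filter.mpr ⟨hp, hl⟩
    exact (Finset.mem_filter.mp this).2
  have col0 : ∀ i j, (i, j) ∈ D' → w ≤ i → n + k ≤ rk D' T (i, j) → j = 0 := by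
    intro i j hp hi hr
    by_contra hj
    have := small (i, j) hp (by
      change L i - j < n + k
      rw [L2 i hi]
      omega)
    omega
  obtain ⟨⟨i, j⟩, hp, hr, hi⟩ := pigeon h1 (r0 := 0) (by omega) c1
  simp only at hi
  have hj := col0 i j hp (by omega) (by omega)
  subst hj
  obtain ⟨⟨i', j'⟩, hq, hqT, hqr⟩ := exists_rk D' T (v := T (i, 0)) (s := n + k) (by omega) (by
    have := rk_le_cnt D' T (i, 0)
    omega)
  by_cases hi' : w ≤ i'
  · have hj' := col0 i' j' hq hi' (by omega)
    subst hj'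
    rcases lt_trichotomy i i' with g | g | g
    · have := h1.col _ _ _ hp hq g; omega
    · subst g; omega
    · have := h1.col _ _ _ hq hp g; omega
  · have hrow : ∀ s < m + k, (i', n + s) ∈ D' ∧ T (i', n + s) = i' + 1 := by
      intro s hs
      have hm : ∀ i0 ≤ i', (i0, n + s) ∈ D' := by
        intro i0 h0
        rw [hD']; unfold inA2; omega
      have a1 := val_le h1 _ i' (n + s) (hm _ le_rfl) rfl
      have a2 := col_ge h1 (s := 0) (j := n + s) i' (by omega) fun i0 _ h0 => hm i0 h0
      exact ⟨hm _ le_rfl, by omega⟩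
    have hv : T (i, 0) = i' + 1 := by
      rw [← hqT]
      have hq1 := (hD' _ _).mp hq
      unfold inA2 at hq1
      have := (hrow (j' - n) (by omega)).2
      rwa [show n + (j' - n) = j' by omega] at this
    have : m + k + 1 ≤ rk D' T (i, 0) := by
      unfold rk pcnt
      conv_lhs => rw [← Finset.card_range (m + k + 1)]
      apply Finset.card_le_card_of_injOn fun s => if s < m + k then (i', n + s) else (i, 0)
      · intro s hs
        simp only [Finset.coe_range, Set.mem_Iio] at hs
        simp only [Finset.mem_filter, Finset.mem_coe]
        split_ifs with g
        · obtain ⟨a1, a2⟩ := hrow s g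
          refine ⟨a1, Or.inl ?_, by rw [a2, hv]⟩
          simp only; omega
        · exact ⟨hp, Or.inr ⟨rfl, le_rfl⟩, rfl⟩
      · intro s hs s' hs' he
        simp only [Finset.coe_range, Set.mem_Iio] at hs hs' he
        split_ifs at he with g1 g2 g2 <;> (try rw [Prod.mk.injEq] at he) <;> omega
    omega

end exceptional

lemma dp_two {lam : YoungDiagram} (h : dp lam = 2) : ∃ b P, 0 < b ∧ b < lam.rowLen 0 ∧ 0 < P ∧
    P < lam.colLen 0 ∧ ∀ i, lam.rowLen i = ell (lam.colLen 0) P b (lam.rowLen 0) i := by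
  unfold dp at h
  obtain ⟨x, y, hxy, he⟩ := Finset.card_eq_two.mp h
  have hR : 0 < lam.colLen 0 := by
    by_contra hR
    rw [show lam.colLen 0 = 0 by omega] at h
    simp at h
  have hmem : ∀ i, i < lam.colLen 0 → lam.rowLen i = x ∨ lam.rowLen i = y := by
    intro i hi
    have : lam.rowLen i ∈ (Finset.range (lam.colLen 0)).image fun i => lam.rowLen i :=
      Finset.mem_image_of_mem _ (Finset.mem_range.mpr hi)
    rw [he] at this
    simpa using this
  have hex : ∀ z, z = x ∨ z = y → ∃ i < lam.colLen 0, lam.rowLen i = z := by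
    intro z hz
    have : z ∈ (Finset.range (lam.colLen 0)).image fun i => lam.rowLen i := by
      rw [he]; simpa using hz
    obtain ⟨i, hi, hi'⟩ := Finset.mem_image.mp this
    exact ⟨i, Finset.mem_range.mp hi, hi'⟩
  obtain ⟨b, hb, hab, hall⟩ : ∃ b, (b = x ∨ b = y) ∧ b ≠ lam.rowLen 0 ∧
      ∀ i < lam.colLen 0, lam.rowLen i = lam.rowLen 0 ∨ lam.rowLen i = b := by
    rcases hmem 0 hR with h0 | h0
    · exact ⟨y, Or.inr rfl, by omega, fun i hi => by have := hmem i hi; omega⟩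
    · exact ⟨x, Or.inl rfl, by omega, fun i hi => by have := hmem i hi; omega⟩
  obtain ⟨i0, hi0, hi0'⟩ := hex b hb
  have a1 := lam.rowLen_anti 0 i0 (by omega)
  have a2 := row_col lam i0 0
  have a3 := row_col lam 0 b
  have a4 := row_col lam i0 b
  refine ⟨b, lam.colLen b, by omega, by omega, by omega, by omega, fun i => ?_⟩
  have b1 := row_col lam i b
  have b2 := row_col lam i 0
  have b3 := hall i
  unfold ell
  split_ifs <;> omega

lemma ell_tr {lam : YoungDiagram} {a b P R : ℕ} (hb : b < a) (hP : P < R)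
    (h : ∀ i, lam.rowLen i = ell R P b a i) (j : ℕ) : lam.colLen j = ell a b P R j := by
  have e : ∀ i, i < lam.colLen j ↔ i < ell a b P R j := by
    intro i
    rw [← row_col, h]
    unfold ell
    split_ifs <;> omega
  have e1 := e (lam.colLen j)
  have e2 := e (ell a b P R j)
  omega

lemma rect_of {mu : YoungDiagram} (h : IsRect mu) (i : ℕ) :
    mu.rowLen i = if i < mu.colLen 0 then mu.rowLen 0 else 0 := by
  split_ifs with hi
  · exact h i hi
  · have := row_col mu i 0
    omega

lemma basic_sum {alp bet : YoungDiagram} {d n : ℕ} (hle : bet ≤ alp)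
    (hb : ∀ i, bet.rowLen i = if i < n then d else 0) (hd : d = 0 ↔ n = 0)
    (hbas : ∀ i, i < alp.colLen 0 → bet.rowLen i < alp.rowLen i) :
    min n (alp.colLen (d + 0) - 0) + (alp.colLen 0 - (0 + n)) = alp.colLen 0 := by
  have h1 : n ≤ alp.colLen 0 := by
    by_contra hh
    have hm : (n - 1, 0) ∈ bet := by
      rw [mem_iff_lt_rowLen, hb, if_pos (by omega)]
      omega
    have := hle hm
    rw [mem_iff_lt_colLen] at this
    omega
  have h2 : n ≤ alp.colLen d := by
    by_contra hh
    have h3 := hbas (n - 1) (by omega)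
    rw [hb, if_pos (by omega), row_col] at h3
    omega
  simp only [Nat.add_zero]
  omega

lemma mem_complRect {a R : ℕ} {nu : YoungDiagram} {i j : ℕ} :
    (i, j) ∈ complRect a R nu ↔ i < R ∧ j < a ∧ ¬ (a - 1 - j < nu.rowLen (R - 1 - i)) := by
  rw [← mem_iff_lt_rowLen]
  change (i, j) ∈ (complRect a R nu).cells ↔ _
  unfold complRect rect
  simp only [Finset.mem_filter, Finset.mem_product, Finset.mem_range, and_assoc]

lemma ext_mem {x y : YoungDiagram} (h : ∀ i j, (i, j) ∈ x ↔ (i, j) ∈ y) : x = y := by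
  ext ⟨i, j⟩
  simpa using h i j

lemma finish_rot {lam mu alp bet : YoungDiagram} {a b c m P R d n : ℕ}
    (hb : 0 < b) (hba : b < a) (hPR : P < R) (hca : c < a) (hmR : m < R)
    (hlr : ∀ i, lam.rowLen i = ell R P b a i)
    (hmr : ∀ i, mu.rowLen i = if i < m then c else 0)
    (hbr : ∀ i, bet.rowLen i = if i < n then d else 0)
    (hn : n + P = R) (hd : d + b = a)
    (hal : ∀ i j, j < alp.rowLen i ↔ (i < R ∧ j < a ∧ (i + m < R ∨ j + c < a))) :
    alp = complRect a R mu ∧ bet = complRect a R lam := by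
  constructor
  · apply ext_mem
    intro i j
    rw [mem_complRect, mem_iff_lt_rowLen, hal, hmr]
    split_ifs <;> omega
  · apply ext_mem
    intro i j
    rw [mem_complRect, mem_iff_lt_rowLen, hbr, hlr]
    unfold ell
    split_ifs <;> omega


theorem dp_two_eq_or_rotation (lam mu alp bet : YoungDiagram)
    (hmu : mu ≤ lam) (hbet : bet ≤ alp)
    (hdp : dp lam = 2) (hrectmu : IsRect mu) (hrectbet : IsRect bet)
    (hbasic1 : IsBasic lam mu) (hconn : IsConnectedSkew lam mu)
    (hbasic2 : IsBasic alp bet)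
    (h : SchurEq lam mu alp bet) :
    (alp = lam ∧ bet = mu) ∨
      (alp = complRect (lam.rowLen 0) (lam.colLen 0) mu ∧
        bet = complRect (lam.rowLen 0) (lam.colLen 0) lam) := by
  obtain ⟨b, P, hb, hba, hP, hPR, hlr⟩ := dp_two hdp
  have hQ := Q_eq hmu hbet h
  have hTr : Tr (skewCells alp bet) (skewCells lam mu) :=
    tr_of_schurEq hbet hmu fun nu => (h nu).symm
  have hmr := rect_of hrectmu
  have hbr := rect_of hrectbet
  have hmc := rect_tr hmr
  have hbc := rect_tr hbr
  have hcm : mu.rowLen 0 = 0 ↔ mu.colLen 0 = 0 := by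
    have := row_col mu 0 0; omega
  have hdn : bet.rowLen 0 = 0 ↔ bet.colLen 0 = 0 := by
    have := row_col bet 0 0; omega
  have hE := E_eq hmr hbr hQ
  have hE' := E_eq_tr hmr hbr hQ
  have hR : alp.colLen 0 = lam.colLen 0 := by
    have := hE 0 0
    rwa [basic_sum hbet hbr hdn hbasic2.1, basic_sum hmu hmr hcm hbasic1.1] at this
  have tr_le : ∀ {x y : YoungDiagram}, x ≤ y → x.transpose ≤ y.transpose := by
    intro x y hxy p hp
    exact YoungDiagram.mem_transpose.mpr (hxy (YoungDiagram.mem_transpose.mp hp))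
  have hA : alp.rowLen 0 = lam.rowLen 0 := by
    have e1 := basic_sum (tr_le hbet) (d := bet.colLen 0) (n := bet.rowLen 0)
      (fun i => by rw [YoungDiagram.rowLen_transpose]; exact hbc i) hdn.symm
      (by simpa only [YoungDiagram.rowLen_transpose, YoungDiagram.colLen_transpose] using hbasic2.2)
    have e2 := basic_sum (tr_le hmu) (d := mu.colLen 0) (n := mu.rowLen 0)
      (fun i => by rw [YoungDiagram.rowLen_transpose]; exact hmc i) hcm.symm
      (by simpa only [YoungDiagram.rowLen_transpose, YoungDiagram.colLen_transpose] using hbasic1.2)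
    rw [YoungDiagram.colLen_transpose, YoungDiagram.colLen_transpose] at e1 e2
    have := hE' 0 0
    rwa [e1, e2] at this
  have hlc := ell_tr hba hPR hlr
  have hca := hbasic1.1 0 (by omega)
  have hmR := hbasic1.2 0 (by omega)
  have hda := hbasic2.1 0 (by omega)
  have hnR := hbasic2.2 0 (by omega)
  rw [hA] at hda
  rw [hR] at hnR
  have hcon : mu.colLen 0 < P ∨ mu.rowLen 0 < b := by
    have h1 := hconn (P - 1) (by omega)
    rw [show P - 1 + 1 = P by omega, hmr, hlr P] at h1
    unfold ell at h1
    split_ifs at h1 <;> omega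
  have hac : ∀ i j, j < alp.rowLen i ↔ i < alp.colLen j := row_col alp
  have hf1 : ∀ t, alp.colLen t = 0 ↔ lam.rowLen 0 ≤ t := by
    intro t
    have := row_col alp 0 t
    omega
  have hf2 : ∀ t, alp.rowLen t = 0 ↔ lam.colLen 0 ≤ t := by
    intro t
    have := row_col alp t 0
    omega
  generalize lam.rowLen 0 = a at *
  generalize lam.colLen 0 = R at *
  generalize mu.rowLen 0 = c at *
  generalize mu.colLen 0 = m at *
  generalize bet.rowLen 0 = d at *
  generalize bet.colLen 0 = n at *
  have fin_id : n = m → d = c → (∀ i j, j < alp.rowLen i ↔ j < lam.rowLen i) →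
      (alp = lam ∧ bet = mu) := by
    intro h1 h2 h3
    refine ⟨ext_mem fun i j => ?_, ext_mem fun i j => ?_⟩
    · rw [mem_iff_lt_rowLen, mem_iff_lt_rowLen]; exact h3 i j
    · rw [mem_iff_lt_rowLen, mem_iff_lt_rowLen, hmr, hbr, h1, h2]
  rcases hcon with hcon | hcon
  · have hE2 : ∀ k t, min n (alp.colLen (d + t) - k) + (alp.colLen t - (k + n)) =
        min m (ell a b P R (c + t) - k) + (ell a b P R t - (k + m)) := by
      intro k t
      rw [← hlc, ← hlc]
      exact hE k t
    rcases comb (f := alp.colLen) hb hba hP hPR hcm hdn hca hda hcon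
      (fun x y hxy => alp.colLen_anti x y hxy) hf1 hE2 with
      ⟨r1, r2, r3⟩ | ⟨r1, r2, r3⟩ | ⟨r1, r2, r3, r4, r5, r6, r7⟩ | ⟨r1, r2, r3, r4, r5, r6, r7⟩
    · left
      apply fin_id r1 r2
      intro i j
      rw [row_col, row_col, r3, hlc]
    · right
      apply finish_rot hb hba hPR hca hmR hlr hmr hbr r1 r2
      intro i j
      rw [row_col, r3]
      split_ifs <;> omega
    · exfalso
      refine no_A1 (n := n) (m := m) (k := P - m) (w := a - c) (b := b) (c := c) (by omega)
        (by omega) (by omega) (by omega) (by omega) (by omega) ?_ ?_ hTr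
      · intro i j
        rw [mem_skew_col, r7, hbc]
        unfold inB
        split_ifs <;> omega
      · intro i j
        rw [mem_skew_col, hlc, hmc]
        unfold inA1 ell
        split_ifs <;> omega
    · exfalso
      refine no_A2 (n := n) (m := R - P) (k := P - m) (w := b) (b := a - c) (c := d) (by omega)
        (by omega) (by omega) (by omega) (by omega) (by omega) ?_ ?_ hTr
      · intro i j
        rw [mem_skew_col, r7, hbc]
        unfold inB
        split_ifs <;> omega
      · intro i j
        rw [mem_skew_col, hlc, hmc]
        unfold inA2 ell
        split_ifs <;> omega
  · have hE2 : ∀ k t, min d (alp.rowLen (n + t) - k) + (alp.rowLen t - (k + d)) =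
        min c (ell R P b a (m + t) - k) + (ell R P b a t - (k + c)) := by
      intro k t
      rw [← hlr, ← hlr]
      exact hE' k t
    rcases comb (f := alp.rowLen) hP hPR hb hba hcm.symm hdn.symm hmR hnR hcon
      (fun x y hxy => alp.rowLen_anti x y hxy) hf2 hE2 with
      ⟨r1, r2, r3⟩ | ⟨r1, r2, r3⟩ | ⟨r1, r2, r3, r4, r5, r6, r7⟩ | ⟨r1, r2, r3, r4, r5, r6, r7⟩
    · left
      apply fin_id r2 r1
      intro i j
      rw [r3, hlr]
    · right
      apply finish_rot hb hba hPR hca hmR hlr hmr hbr r2 r1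
      intro i j
      rw [r3]
      split_ifs <;> omega
    · exfalso
      refine no_A1T (n := d) (m := c) (k := b - c) (w := R - m) (b := P) (c := m) (by omega)
        (by omega) (by omega) (by omega) (by omega) (by omega) ?_ ?_ hTr
      · intro i j
        rw [mem_skew, r7, hbr]
        unfold inB
        split_ifs <;> omega
      · intro i j
        rw [mem_skew, hlr, hmr]
        unfold inA1 ell
        split_ifs <;> omega
    · exfalso
      refine no_A2T (n := d) (m := a - b) (k := b - c) (w := P) (b := R - m) (c := n) (by omega)
        (by omega) (by omega) (by omega) (by omega) (by omega) ?_ ?_ hTr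
      · intro i j
        rw [mem_skew, r7, hbr]
        unfold inB
        split_ifs <;> omega
      · intro i j
        rw [mem_skew, hlr, hmr]
        unfold inA2 ell
        split_ifs <;> omega

end LRSkew
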